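/- arXiv:2305.08011 — 3 statements merged into one kernel-verified Lean document; each statement's English description precedes it below -/
import Mathlib

section
/- Let G be a discrete convergence group acting on a compact metrizable space M. Let Y be a subset of M containing at least two points, let K₁, K₂ be disjoint compact subsets of M, and let x ∈ M. If there exists a sequence (g_k) of pairwise distinct elements of G such that for all k one has g_k x ∈ K₂ and g_k Y ⊆ K₁, then x is a conical limit point for G. -/
open Filter Topology Set

namespace ConvergenceGroups

variable {M : Type*} [TopologicalSpace M]

/-- The group of self-homeomorphisms of `M`, with `(g * h) x = g (h x)`. -/
instance : Group (M ≃ₜ M) where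
  mul g h := h.trans g
  one := Homeomorph.refl M
  inv := Homeomorph.symm
  mul_assoc _ _ _ := rfl
  one_mul _ := Homeomorph.ext fun _ => rfl
  mul_one _ := Homeomorph.ext fun _ => rfl
  inv_mul_cancel g := Homeomorph.ext fun x => g.symm_apply_apply x

/-- The inclusion of the self-homeomorphisms of `M` into the continuous self-maps of `M`;
the latter carries the compact-open topology. -/
def toCM (g : M ≃ₜ M) : C(M, M) := ⟨⇑g, g.continuous⟩

/-- `(g k)` is a convergence sequence with attracting point `zp` and repelling point `zm`:
the maps `g k` converge to the constant map `zp` uniformly on compact subsets of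
`M ∖ {zm}`. -/
def IsConvSeq (g : ℕ → M ≃ₜ M) (zp zm : M) : Prop :=
  ∀ K : Set M, IsCompact K → zm ∉ K → ∀ U ∈ 𝓝 zp,
    ∀ᶠ k in atTop, ∀ x ∈ K, g k x ∈ U

/-- `(g k)` converges in the compact-open topology to a homeomorphism. -/
def TendstoHomeo (g : ℕ → M ≃ₜ M) : Prop :=
  ∃ h : M ≃ₜ M, Tendsto (fun k => toCM (g k)) atTop (𝓝 (toCM h))

/-- `G` acts on `M` as a convergence group: every sequence of pairwise distinct elements of
`G` has a subsequence which either converges in the compact-open topology to a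
homeomorphism, or is a convergence sequence. -/
def IsConvGroup (G : Subgroup (M ≃ₜ M)) : Prop :=
  ∀ g : ℕ → M ≃ₜ M, (∀ k, g k ∈ G) → Function.Injective g →
    ∃ φ : ℕ → ℕ, StrictMono φ ∧
      (TendstoHomeo (g ∘ φ) ∨ ∃ zp zm : M, IsConvSeq (g ∘ φ) zp zm)

/-- `G` acts on `M` as a discrete convergence group: every sequence of pairwise distinct
elements of `G` has a subsequence which is a convergence sequence. -/
def IsDiscreteConvGroup (G : Subgroup (M ≃ₜ M)) : Prop :=
  ∀ g : ℕ → M ≃ₜ M, (∀ k, g k ∈ G) → Function.Injective g →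
    ∃ φ : ℕ → ℕ, StrictMono φ ∧ ∃ zp zm : M, IsConvSeq (g ∘ φ) zp zm

/-- The limit set `Λ(G)`: the set of all attracting points of convergence sequences in `G`. -/
def limitSet (G : Subgroup (M ≃ₜ M)) : Set M :=
  {zp | ∃ g : ℕ → M ≃ₜ M, (∀ k, g k ∈ G) ∧ Function.Injective g ∧
    ∃ zm : M, IsConvSeq g zp zm}

/-- `x` is a conical limit point for `G`: there is a sequence of pairwise distinct elements
`g k` of `G` such that for every `z ≠ x` the pairs `(g k x, g k z)` remain in a compact
subset of `(M × M) ∖ Δ`. -/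
def IsConicalLimitPt (G : Subgroup (M ≃ₜ M)) (x : M) : Prop :=
  ∃ g : ℕ → M ≃ₜ M, (∀ k, g k ∈ G) ∧ Function.Injective g ∧
    ∀ z : M, z ≠ x → ∃ K : Set (M × M), IsCompact K ∧ (∀ p ∈ K, p.1 ≠ p.2) ∧
      ∀ k, (g k x, g k z) ∈ K

/-- `g` is elliptic: the closure of the cyclic group generated by `g` is compact in
`Homeo(M)` (viewed inside `C(M, M)` with the compact-open topology). -/
def IsEllipticElem (g : M ≃ₜ M) : Prop :=
  IsCompact (closure (Set.range fun n : ℤ => toCM (g ^ n))) ∧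
    closure (Set.range fun n : ℤ => toCM (g ^ n)) ⊆ Set.range (toCM (M := M))

/-- `g` is parabolic: not elliptic, and fixes exactly one point of `M`. -/
def IsParabolicElem (g : M ≃ₜ M) : Prop :=
  ¬IsEllipticElem g ∧ ∃! x : M, g x = x

/-- `g` is loxodromic: not elliptic, and fixes exactly two points of `M`. -/
def IsLoxodromicElem (g : M ≃ₜ M) : Prop :=
  ¬IsEllipticElem g ∧ ∃ a b : M, a ≠ b ∧ {x : M | g x = x} = {a, b}

/-- `p` is a parabolic point for `G`: it is the fixed point of a parabolic element of `G`. -/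
def IsParabolicPt (G : Subgroup (M ≃ₜ M)) (p : M) : Prop :=
  ∃ g ∈ G, IsParabolicElem g ∧ g p = p

/-- `p` is a bounded parabolic point for `G`: it is a parabolic point and the quotient of
`Λ(G) ∖ {p}` by the stabilizer of `p` in `G` is compact. -/
def IsBoundedParabolicPt (G : Subgroup (M ≃ₜ M)) (p : M) : Prop :=
  IsParabolicPt G p ∧
    ∃ K : Set M, IsCompact K ∧ K ⊆ limitSet G \ {p} ∧
      ∀ x ∈ limitSet G \ {p}, ∃ h ∈ G, h p = p ∧ h x ∈ K

/-- `G` is geometrically finite: every point of `Λ(G)` is a conical limit point or a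
bounded parabolic point. -/
def IsGeomFinite (G : Subgroup (M ≃ₜ M)) : Prop :=
  ∀ x ∈ limitSet G, IsConicalLimitPt G x ∨ IsBoundedParabolicPt G x

/-- `J` is a fully quasi-convex subgroup of `G`: `J ≤ G`, `J` acts geometrically finitely,
and `g Λ(J) ∩ Λ(J) = ∅` for all but finitely many left cosets `gJ`. -/
def IsFullyQuasiconvex (G J : Subgroup (M ≃ₜ M)) : Prop :=
  J ≤ G ∧ IsGeomFinite J ∧
    ∃ F : Set (M ≃ₜ M), F.Finite ∧ ∀ g ∈ G,
      (⇑g '' limitSet J ∩ limitSet J).Nonempty → ∃ f ∈ F, ∃ j ∈ J, g = f * j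

/-- `G₁` and `G₂` are in AFP ping-pong position with respect to `J = G₁ ∩ G₂`, witnessed by
the closed sets `B₁`, `B₂`. -/
structure AFPPingPong (G₁ G₂ J : Subgroup (M ≃ₜ M)) (B₁ B₂ : Set M) : Prop where
  isClosed₁ : IsClosed B₁
  isClosed₂ : IsClosed B₂
  int_nonempty₁ : (interior B₁).Nonempty
  int_nonempty₂ : (interior B₂).Nonempty
  int_disjoint : interior B₁ ∩ interior B₂ = ∅
  inv₁ : ∀ j ∈ J, ⇑j '' B₁ = B₁
  inv₂ : ∀ j ∈ J, ⇑j '' B₂ = B₂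
  pp₁ : ∀ g ∈ G₁, g ∉ J → ⇑g '' B₁ ⊆ interior B₂
  pp₂ : ∀ g ∈ G₂, g ∉ J → ⇑g '' B₂ ⊆ interior B₁
  lim₁ : limitSet G₁ \ limitSet J ⊆ interior B₂
  lim₂ : limitSet G₂ \ limitSet J ⊆ interior B₁

/-- `G₀` is in HNN ping-pong position with respect to `f`, `J₁`, `J₋₁`, witnessed by the
closed sets `B₁`, `Bm` (where `Bm` plays the role of `B₋₁`). -/
structure HNNPingPong (G₀ J₁ Jm : Subgroup (M ≃ₜ M)) (f : M ≃ₜ M) (B₁ Bm : Set M) :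
    Prop where
  isClosed₁ : IsClosed B₁
  isClosedm : IsClosed Bm
  int_nonempty₁ : (interior B₁).Nonempty
  int_nonemptym : (interior Bm).Nonempty
  int_disjoint : interior B₁ ∩ interior Bm = ∅
  inv₁ : ∀ j ∈ J₁, ⇑j '' B₁ = B₁
  invm : ∀ j ∈ Jm, ⇑j '' Bm = Bm
  prec₁ : ∀ g ∈ G₀, g ∉ J₁ → ⇑g '' B₁ ∩ B₁ = ∅
  precm : ∀ g ∈ G₀, g ∉ Jm → ⇑g '' Bm ∩ Bm = ∅
  cross : ∀ g ∈ G₀, ⇑g '' B₁ ∩ Bm = ∅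
  mapf : ⇑f '' ((B₁ ∪ Bm)ᶜ ∪ B₁) = interior B₁
  lim₁ : limitSet G₀ ∩ B₁ = limitSet J₁
  limm : limitSet G₀ ∩ Bm = limitSet Jm
  proper : (⋃ g ∈ G₀, ⇑g '' (B₁ ∪ Bm))ᶜ.Nonempty

/-- A letter of type `i` (`i = 0` for `G₁`, `i = 1` for `G₂`) for amalgamated free product
normal forms: an element of `G_{i+1} ∖ J`. -/
def AFPLetter (G₁ G₂ J : Subgroup (M ≃ₜ M)) (i : Fin 2) (g : M ≃ₜ M) : Prop :=
  g ∈ (if i = 0 then G₁ else G₂) ∧ g ∉ J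

/-- `h` is an `(i,j)`-form: a product of a nonempty alternating list of letters, whose first
letter lies in `G_i ∖ J` and whose last letter lies in `G_j ∖ J` (indices shifted so that
`0` stands for `G₁` and `1` for `G₂`). -/
def IsIJForm (G₁ G₂ J : Subgroup (M ≃ₜ M)) (i j : Fin 2) (h : M ≃ₜ M) : Prop :=
  ∃ l : List (M ≃ₜ M), l ≠ [] ∧ l.prod = h ∧
    (∀ g ∈ l, AFPLetter G₁ G₂ J 0 g ∨ AFPLetter G₁ G₂ J 1 g) ∧
    l.Chain' (fun a b => ∀ c : Fin 2, AFPLetter G₁ G₂ J c a → AFPLetter G₁ G₂ J (1 - c) b) ∧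
    (∀ hne : l ≠ [], AFPLetter G₁ G₂ J i (l.head hne)) ∧
    (∀ hne : l ≠ [], AFPLetter G₁ G₂ J j (l.getLast hne))

theorem IsConvSeq.tendsto {g : ℕ → M ≃ₜ M} {zp zm z : M} (h : IsConvSeq g zp zm)
    (hz : z ≠ zm) : Tendsto (fun k => g k z) atTop (𝓝 zp) := fun U hU =>
  (h {z} isCompact_singleton (fun hm => hz hm.symm) U hU).mono fun _ hk => hk z rfl

/-- If `u k` stays in a compact set which misses the limit of `v k`, and `u k ≠ v k` for all
`k`, then the pairs `(u k, v k)` remain in a compact subset of the complement of the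
diagonal. -/
theorem exists_isCompact_offDiag_of_tendsto [CompactSpace M] [RegularSpace M] {u v : ℕ → M}
    {K : Set M} {p : M} (hK : IsCompact K) (hKc : IsClosed K) (hu : ∀ k, u k ∈ K)
    (hp : p ∉ K) (hv : Tendsto v atTop (𝓝 p)) (huv : ∀ k, u k ≠ v k) :
    ∃ L : Set (M × M), IsCompact L ∧ (∀ q ∈ L, q.1 ≠ q.2) ∧ ∀ k, (u k, v k) ∈ L := by
  obtain ⟨C, hCp, hC, hCK⟩ := exists_mem_nhds_isClosed_subset (hKc.isOpen_compl.mem_nhds hp)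
  obtain ⟨N, hN⟩ := eventually_atTop.1 (hv hCp)
  refine ⟨(fun k => (u k, v k)) '' Iio N ∪ K ×ˢ C,
    ((finite_Iio N).image _).isCompact.union (hK.prod hC.isCompact), ?_, fun k => ?_⟩
  · rintro q (⟨k, -, rfl⟩ | ⟨h₁, h₂⟩)
    · exact huv k
    · intro h
      exact hCK h₂ (h ▸ h₁)
  · rcases lt_or_ge k N with hk | hk
    · exact Or.inl ⟨k, hk, rfl⟩
    · exact Or.inr ⟨hu k, hN k hk⟩

/-- Let `G` be a discrete convergence group acting on a compact metrizable
space `M`. Let `Y ⊆ M` contain at least two points, let `K₁, K₂` be disjoint compact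
subsets of `M`, and let `x ∈ M`. If there is a sequence `(g k)` of pairwise distinct
elements of `G` with `g k x ∈ K₂` and `g k '' Y ⊆ K₁` for all `k`, then `x` is a conical
limit point for `G`. -/
theorem statement_1 {M : Type*} [TopologicalSpace M] [CompactSpace M]
    [TopologicalSpace.MetrizableSpace M]
    (G : Subgroup (M ≃ₜ M)) (hG : IsDiscreteConvGroup G)
    (Y : Set M) (hY : ∃ a ∈ Y, ∃ b ∈ Y, a ≠ b)
    (K₁ K₂ : Set M) (hK₁ : IsCompact K₁) (hK₂ : IsCompact K₂) (hdisj : Disjoint K₁ K₂)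
    (x : M) (g : ℕ → M ≃ₜ M) (hgG : ∀ k, g k ∈ G) (hginj : Function.Injective g)
    (hgx : ∀ k, g k x ∈ K₂) (hgY : ∀ k, ⇑(g k) '' Y ⊆ K₁) :
    IsConicalLimitPt G x := by
  obtain ⟨φ, hφ, zp, zm, hconv⟩ := hG g hgG hginj
  have hzp : zp ∈ K₁ := by
    obtain ⟨a, ha, hazm⟩ : ∃ a ∈ Y, a ≠ zm := (show Y.Nontrivial from hY).exists_ne zm
    exact hK₁.isClosed.mem_of_tendsto (hconv.tendsto hazm)
      (Eventually.of_forall fun k => hgY (φ k) (mem_image_of_mem _ ha))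
  have hzp₂ : zp ∉ K₂ := disjoint_left.1 hdisj hzp
  obtain rfl : x = zm := by
    by_contra hx
    exact hzp₂ (hK₂.isClosed.mem_of_tendsto (hconv.tendsto hx)
      (Eventually.of_forall fun k => hgx (φ k)))
  exact ⟨g ∘ φ, fun k => hgG (φ k), hginj.comp hφ.injective, fun z hz =>
    exists_isCompact_offDiag_of_tendsto hK₂ hK₂.isClosed (fun k => hgx (φ k)) hzp₂
      (hconv.tendsto hz) fun k h => hz ((g (φ k)).injective h).symm⟩

end ConvergenceGroups
end

section
/- Let G be a discrete convergence group acting on a compact metrizable space M such that every point of M is either a conical limit point or a bounded parabolic point for G (so G is geometrically finite and Λ(G) = M), and let J₁, J₂ be fully quasi-convex subgroups of G. Then for any sequence (g_k) in G, there exist j_k ∈ J₁ and j_k' ∈ J₂ such that the sequence (j_k g_k j_k') has no attracting points in Λ(J₁) and no repelling points in Λ(J₂); that is, no convergence subsequence of (j_k g_k j_k') has its attracting point in Λ(J₁) or its repelling point in Λ(J₂). -/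
open Filter Topology Set

namespace ConvergenceGroups

variable {M : Type*} [TopologicalSpace M]

theorem mul_apply (g h : M ≃ₜ M) (x : M) : (g * h) x = g (h x) := rfl

theorem one_apply (x : M) : (1 : M ≃ₜ M) x = x := rfl

theorem inv_apply_self (g : M ≃ₜ M) (x : M) : g⁻¹ (g x) = x := g.symm_apply_apply x

theorem apply_inv_self (g : M ≃ₜ M) (x : M) : g (g⁻¹ x) = x := g.apply_symm_apply x

/-- The powers of a conjugate are the conjugates of the powers. -/
theorem conj_pow_apply (f q : M ≃ₜ M) (n : ℕ) (x : M) :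
    ((f * q * f⁻¹) ^ n) (f x) = f ((q ^ n) x) := by
  rw [conj_pow, mul_apply, mul_apply, inv_apply_self]

theorem isConvSeq_iff [CompactSpace M] [T2Space M] {g : ℕ → M ≃ₜ M} {zp zm : M} :
    IsConvSeq g zp zm ↔
      ∀ U ∈ 𝓝 zm, ∀ V ∈ 𝓝 zp, ∀ᶠ k in atTop, ∀ x ∉ U, g k x ∈ V := by
  constructor
  · intro h U hU V hV
    have hK : IsCompact (interior U)ᶜ := isOpen_interior.isClosed_compl.isCompact
    filter_upwards [h _ hK (by simpa using mem_interior_iff_mem_nhds.2 hU) V hV] with k hk x hx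
    exact hk x fun hx' => hx (interior_subset hx')
  · intro h K hK hzm U hU
    filter_upwards [h Kᶜ (hK.isClosed.isOpen_compl.mem_nhds hzm) U hU] with k hk x hx
    exact hk x (by simpa using hx)

namespace IsConvSeq

theorem comp {g : ℕ → M ≃ₜ M} {zp zm : M} (h : IsConvSeq g zp zm) {φ : ℕ → ℕ}
    (hφ : Tendsto φ atTop atTop) : IsConvSeq (g ∘ φ) zp zm :=
  fun K hK hzm U hU => hφ.eventually (h K hK hzm U hU)

variable [CompactSpace M] [T2Space M] {g h : ℕ → M ≃ₜ M} {zp zm wp wm : M}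

theorem eventually (hg : IsConvSeq g zp zm) {U V : Set M} (hU : U ∈ 𝓝 zm) (hV : V ∈ 𝓝 zp) :
    ∀ᶠ k in atTop, ∀ x ∉ U, g k x ∈ V :=
  isConvSeq_iff.1 hg U hU V hV

theorem inv (hg : IsConvSeq g zp zm) : IsConvSeq (fun k => (g k)⁻¹) zm zp := by
  rw [isConvSeq_iff]
  intro U hU V hV
  filter_upwards [hg.eventually hV hU] with k hk x hx
  by_contra hx'
  exact hx (by simpa only [apply_inv_self] using hk _ hx')

theorem tendsto_apply (hg : IsConvSeq g zp zm) {x : ℕ → M} {y : M}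
    (hx : Tendsto x atTop (𝓝 y)) (hy : y ≠ zm) : Tendsto (fun k => g k (x k)) atTop (𝓝 zp) := by
  rw [tendsto_def]
  intro V hV
  obtain ⟨A, B, hA, hB, hyA, hzB, hAB⟩ := t2_separation hy
  filter_upwards [hg.eventually (hB.mem_nhds hzB) hV, hx.eventually_mem (hA.mem_nhds hyA)] with k hk hxk
  exact hk _ fun h' => hAB.le_bot ⟨hxk, h'⟩

theorem tendsto_const (hg : IsConvSeq g zp zm) {y : M} (hy : y ≠ zm) :
    Tendsto (fun k => g k y) atTop (𝓝 zp) :=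
  hg.tendsto_apply tendsto_const_nhds hy

theorem mul (hg : IsConvSeq g zp zm) (hh : IsConvSeq h wp wm) (hne : wp ≠ zm) :
    IsConvSeq (fun k => g k * h k) zp wm := by
  rw [isConvSeq_iff]
  intro U hU V hV
  obtain ⟨A, B, hA, hB, hyA, hzB, hAB⟩ := t2_separation hne
  filter_upwards [hg.eventually (hB.mem_nhds hzB) hV, hh.eventually hU (hA.mem_nhds hyA)]
    with k hgk hhk x hx
  exact hgk _ fun h' => hAB.le_bot ⟨hhk x hx, h'⟩

theorem const_mul (hg : IsConvSeq g zp zm) (c : M ≃ₜ M) :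
    IsConvSeq (fun k => c * g k) (c zp) zm := by
  rw [isConvSeq_iff]
  intro U hU V hV
  filter_upwards [hg.eventually hU (c.continuous.continuousAt hV)] with k hk x hx
  exact hk x hx

theorem mul_const (hg : IsConvSeq g zp zm) (c : M ≃ₜ M) :
    IsConvSeq (fun k => g k * c) zp (c⁻¹ zm) := by
  simpa only [mul_inv_rev, inv_inv] using (hg.inv.const_mul c⁻¹).inv

theorem attracting_unique [Infinite M] (hg : IsConvSeq g zp zm) (hg' : IsConvSeq g wp wm) :
    zp = wp := by
  obtain ⟨x, hx⟩ := (Set.toFinite ({zm, wm} : Set M)).exists_notMem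
  rw [Set.mem_insert_iff, Set.mem_singleton_iff, not_or] at hx
  exact tendsto_nhds_unique (hg.tendsto_const hx.1) (hg'.tendsto_const hx.2)

theorem repelling_unique [Infinite M] (hg : IsConvSeq g zp zm) (hg' : IsConvSeq g wp wm) :
    zm = wm :=
  hg.inv.attracting_unique hg'.inv

end IsConvSeq

theorem IsDiscreteConvGroup.mono {G J : Subgroup (M ≃ₜ M)} (hG : IsDiscreteConvGroup G)
    (hJ : J ≤ G) : IsDiscreteConvGroup J :=
  fun g hg => hG g fun k => hJ (hg k)

/-- A sequence in a discrete convergence group has a subsequence that is constant or an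
injective convergence sequence. -/
theorem IsDiscreteConvGroup.exists_subseq {G : Subgroup (M ≃ₜ M)} (hG : IsDiscreteConvGroup G)
    {u : ℕ → M ≃ₜ M} (hu : ∀ k, u k ∈ G) :
    ∃ φ : ℕ → ℕ, StrictMono φ ∧ ((∃ c, ∀ k, u (φ k) = c) ∨
      (Function.Injective (u ∘ φ) ∧ ∃ zp zm, IsConvSeq (u ∘ φ) zp zm)) := by
  classical
  by_cases hc : ∃ c, ∃ᶠ k in atTop, u k = c
  · obtain ⟨c, hc⟩ := hc
    obtain ⟨φ, hφ, h⟩ := extraction_of_frequently_atTop hc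
    exact ⟨φ, hφ, Or.inl ⟨c, h⟩⟩
  push Not at hc
  obtain ⟨ψ, -, hψ⟩ := exists_seq_of_forall_finset_exists (fun _ : ℕ => True)
    (fun a b => a < b ∧ u b ≠ u a) (by
      intro s _
      have : ∀ᶠ b in atTop, ∀ a ∈ s, a < b ∧ u b ≠ u a := by
        rw [Filter.eventually_all_finset]
        exact fun a _ => (eventually_gt_atTop a).and (hc (u a))
      obtain ⟨b, hb⟩ := this.exists
      exact ⟨b, trivial, hb⟩)
  have hmono : StrictMono ψ := fun m n hmn => (hψ m n hmn).1
  have hinj : Function.Injective (u ∘ ψ) := by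
    intro m n hmn
    by_contra hne
    rcases lt_or_gt_of_ne hne with h | h
    · exact (hψ _ _ h).2 hmn.symm
    · exact (hψ _ _ h).2 hmn
  obtain ⟨φ, hφ, zp, zm, h⟩ := hG (u ∘ ψ) (fun k => hu _) hinj
  exact ⟨ψ ∘ φ, hmono.comp hφ, Or.inr ⟨hinj.comp hφ.injective, zp, zm, h⟩⟩

theorem limitSet_eq_empty [Finite M] (G : Subgroup (M ≃ₜ M)) : limitSet G = ∅ := by
  have : Finite (M ≃ₜ M) := Finite.of_injective _ DFunLike.coe_injective
  rw [Set.eq_empty_iff_forall_notMem]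
  rintro x ⟨g, -, hg, -⟩
  exact not_injective_infinite_finite g hg

theorem mem_limitSet_of_repelling [CompactSpace M] [T2Space M] {G : Subgroup (M ≃ₜ M)}
    {g : ℕ → M ≃ₜ M} {zp zm : M} (hgG : ∀ k, g k ∈ G) (hinj : Function.Injective g)
    (hg : IsConvSeq g zp zm) : zm ∈ limitSet G :=
  ⟨fun k => (g k)⁻¹, fun k => G.inv_mem (hgG k), inv_injective.comp hinj, zp, hg.inv⟩

section Metric

variable {X : Type*} [MetricSpace X] [CompactSpace X] [Infinite X]
  {G J : Subgroup (X ≃ₜ X)} {p : X}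

theorem IsConicalLimitPt.exists_isConvSeq (hG : IsDiscreteConvGroup G)
    (hp : IsConicalLimitPt G p) :
    ∃ (f : ℕ → X ≃ₜ X) (a b : X), (∀ k, f k ∈ G) ∧ Function.Injective f ∧ a ≠ b ∧
      IsConvSeq f a p ∧ Tendsto (fun k => f k p) atTop (𝓝 b) := by
  obtain ⟨g, hg, hinj, hK⟩ := hp
  obtain ⟨φ, hφ, a, zm, hconv⟩ := hG g hg hinj
  obtain rfl : zm = p := by
    by_contra hne
    obtain ⟨z, hz⟩ := (Set.toFinite ({zm, p} : Set X)).exists_notMem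
    rw [Set.mem_insert_iff, Set.mem_singleton_iff, not_or] at hz
    obtain ⟨K, hK, hdiag, hmem⟩ := hK z hz.2
    have h := (hconv.tendsto_const (Ne.symm hne)).prodMk_nhds (hconv.tendsto_const hz.1)
    exact hdiag _ (hK.isClosed.mem_of_tendsto h (Eventually.of_forall fun k => hmem _)) rfl
  obtain ⟨b, ψ, hψ, hb⟩ := CompactSpace.tendsto_subseq fun k => g (φ k) zm
  have hconv' := hconv.comp hψ.tendsto_atTop
  refine ⟨g ∘ φ ∘ ψ, a, b, fun k => hg _, hinj.comp (hφ.comp hψ).injective, ?_, hconv', hb⟩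
  obtain ⟨z, hz⟩ := (Set.toFinite ({zm} : Set X)).exists_notMem
  rw [Set.mem_singleton_iff] at hz
  obtain ⟨K, hK, hdiag, hmem⟩ := hK z hz
  have h := hb.prodMk_nhds (hconv'.tendsto_const hz)
  exact (hdiag _ (hK.isClosed.mem_of_tendsto h (Eventually.of_forall fun k => hmem _))).symm

theorem IsParabolicElem.injective_pow {Y : Type*} [MetricSpace Y] {q : Y ≃ₜ Y} (hq : IsParabolicElem q) :
    Function.Injective fun n : ℕ => q ^ n := by
  rw [injective_pow_iff_not_isOfFinOrder]
  intro hfin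
  apply hq.1
  have hfin' : (Set.range fun n : ℤ => toCM (q ^ n)).Finite := by
    refine ((finite_zpowers.2 hfin).image toCM).subset ?_
    rintro _ ⟨n, rfl⟩
    exact ⟨q ^ n, ⟨n, rfl⟩, rfl⟩
  rw [IsEllipticElem, hfin'.isClosed.closure_eq]
  refine ⟨hfin'.isCompact, ?_⟩
  rintro _ ⟨n, rfl⟩
  exact ⟨_, rfl⟩

/-- The powers of an element of infinite order with a unique fixed point `p` contain a
convergence sequence with attracting and repelling point `p`. -/
theorem exists_isConvSeq_pow (hG : IsDiscreteConvGroup G) {q : X ≃ₜ X} (hqG : q ∈ G)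
    (hfix : ∀ x, q x = x → x = p) (hinj : Function.Injective fun n : ℕ => q ^ n) :
    ∃ φ : ℕ → ℕ, StrictMono φ ∧ IsConvSeq (fun k => q ^ φ k) p p := by
  obtain ⟨φ, hφ, a, b, h⟩ := hG _ (fun k => G.pow_mem hqG k) hinj
  have h' := (h.const_mul q).mul_const q⁻¹
  have heq : (fun k => q * ((fun n : ℕ => q ^ n) ∘ φ) k * q⁻¹) = (fun n : ℕ => q ^ n) ∘ φ := by
    funext k
    simp only [Function.comp]
    rw [← pow_succ', pow_succ, mul_inv_cancel_right]
  rw [heq, inv_inv] at h'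
  have ha := hfix a (h.attracting_unique h').symm
  have hb := hfix b (h.repelling_unique h').symm
  subst ha hb
  exact ⟨φ, hφ, h⟩

theorem IsParabolicPt.mem_limitSet (hG : IsDiscreteConvGroup G) (hp : IsParabolicPt G p) :
    p ∈ limitSet G := by
  obtain ⟨q, hqG, hq, hqp⟩ := hp
  obtain ⟨φ, hφ, h⟩ := exists_isConvSeq_pow hG hqG (fun x hx => hq.2.unique hx hqp)
    hq.injective_pow
  exact ⟨_, fun k => G.pow_mem hqG _, hq.injective_pow.comp hφ.injective, p, h⟩

theorem not_isConvSeq_conj (hG : IsDiscreteConvGroup G) {q : X ≃ₜ X} (hqG : q ∈ G)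
    (hfix : ∀ x, q x = x → x = p) (hinj : Function.Injective fun n : ℕ => q ^ n)
    {f : ℕ → X ≃ₜ X} {a b : X} (hab : a ≠ b) (hf : IsConvSeq f a p)
    (hfp : Tendsto (fun k => f k p) atTop (𝓝 b)) :
    ¬IsConvSeq (fun k => f k * q * (f k)⁻¹) a b := by
  intro hr
  obtain ⟨φ, -, hpow⟩ := exists_isConvSeq_pow hG hqG hfix hinj
  obtain ⟨A, B, hA, hB, haA, hbB, hAB⟩ := t2_separation hab
  obtain ⟨z, hz⟩ := (Set.toFinite ({p} : Set X)).exists_notMem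
  obtain ⟨k, hk₁, hk₂, hk₃⟩ := (((hf.tendsto_const hz).eventually (hA.mem_nhds haA)).and
    ((hr.eventually (hB.mem_nhds hbB) (hA.mem_nhds haA)).and
      (hfp.eventually (hB.mem_nhds hbB)))).exists
  have hmem : ∀ n : ℕ, f k ((q ^ n) z) ∈ A := by
    intro n
    rw [← conj_pow_apply]
    induction n with
    | zero => exact hk₁
    | succ n ih =>
      rw [pow_succ', mul_apply]
      exact hk₂ _ fun h' => hAB.le_bot ⟨ih, h'⟩
  obtain ⟨n, hn⟩ := ((hpow.tendsto_const hz).eventually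
    ((f k).continuous.continuousAt (hB.mem_nhds hk₃))).exists
  exact hAB.le_bot ⟨hmem _, hn⟩

/-- A parabolic point is not conical. -/
theorem IsParabolicPt.eq_of_isConvSeq (hG : IsDiscreteConvGroup G) (hp : IsParabolicPt G p)
    {f : ℕ → X ≃ₜ X} (hfG : ∀ k, f k ∈ G) {a b : X} (hf : IsConvSeq f a p)
    (hfp : Tendsto (fun k => f k p) atTop (𝓝 b)) : a = b := by
  by_contra hab
  obtain ⟨q, hqG, hq, hqp⟩ := hp
  have hfix : ∀ x, q x = x → x = p := fun x hx => hq.2.unique hx hqp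
  obtain ⟨φ, hφ, h⟩ := hG.exists_subseq (u := fun k => f k * q * (f k)⁻¹)
    fun k => G.mul_mem (G.mul_mem (hfG k) hqG) (G.inv_mem (hfG k))
  replace hf := hf.comp hφ.tendsto_atTop
  replace hfp := hfp.comp hφ.tendsto_atTop
  obtain ⟨z, hz⟩ := (Set.toFinite ({p} : Set X)).exists_notMem
  rw [Set.mem_singleton_iff] at hz
  have hqz : q z ≠ p := fun h' => hz (q.injective (h'.trans hqp.symm))
  have hrz : ∀ k x, (f k * q * (f k)⁻¹) (f k x) = f k (q x) := fun k x => by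
    simp only [mul_apply, inv_apply_self]
  have hz₁ := hf.tendsto_const hz
  have hz₂ := hf.tendsto_const hqz
  rcases h with ⟨c, hc⟩ | ⟨-, α, β, h⟩
  · have key : ∀ y, c y = y → (f (φ 0))⁻¹ y = p := by
      intro y hy
      apply hfix
      apply (f (φ 0)).injective
      rw [← hrz, apply_inv_self, hc, hy]
    have ha : c a = a := by
      refine tendsto_nhds_unique ((c.continuous.tendsto a).comp hz₁) (hz₂.congr fun k => ?_)
      simp only [Function.comp]
      rw [← hrz, hc]
    have hb : c b = b := by
      refine tendsto_nhds_unique ((c.continuous.tendsto b).comp hfp) (hfp.congr fun k => ?_)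
      simp only [Function.comp]
      rw [← hc k, hrz, hqp]
    exact hab ((f (φ 0))⁻¹.injective ((key a ha).trans (key b hb).symm))
  · have ha : a ≠ β → α = a := fun hne =>
      tendsto_nhds_unique (h.tendsto_apply hz₁ hne) (hz₂.congr fun k => (hrz _ _).symm)
    have hb : b ≠ β → α = b := fun hne =>
      tendsto_nhds_unique (h.tendsto_apply hfp hne)
        (hfp.congr fun k => by simp only [Function.comp]; rw [hrz, hqp])
    by_cases haβ : a = β
    · subst haβ
      obtain rfl := hb (Ne.symm hab)
      refine not_isConvSeq_conj hG (q := q⁻¹) (G.inv_mem hqG) ?_ ?_ hab hf hfp ?_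
      · intro x hx
        exact hfix x (by nth_rewrite 1 [← hx]; exact apply_inv_self _ _)
      · simp only [inv_pow]
        exact inv_injective.comp hq.injective_pow
      · have := h.inv
        simpa only [Function.comp, mul_inv_rev, inv_inv, mul_assoc] using this
    · obtain rfl := ha haβ
      by_cases hbβ : b = β
      · subst hbβ
        exact not_isConvSeq_conj hG hqG hfix hq.injective_pow hab hf hfp h
      · exact hab (hb hbβ)

theorem IsParabolicPt.not_isConicalLimitPt (hG : IsDiscreteConvGroup G)
    (hp : IsParabolicPt G p) : ¬IsConicalLimitPt G p := by
  intro hc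
  obtain ⟨f, a, b, hfG, -, hab, hf, hfp⟩ := hc.exists_isConvSeq hG
  exact hab (hp.eq_of_isConvSeq hG hfG hf hfp)

/-- A convergence sequence in the stabilizer of a parabolic point has this point as
attracting and repelling point. -/
theorem IsParabolicPt.eq_of_stabilizer (hG : IsDiscreteConvGroup G) (hp : IsParabolicPt G p)
    {f : ℕ → X ≃ₜ X} (hfG : ∀ k, f k ∈ G) (hfp : ∀ k, f k p = p) {a b : X}
    (hf : IsConvSeq f a b) : a = p ∧ b = p := by
  have hconst : Tendsto (fun k => f k p) atTop (𝓝 p) := by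
    simp only [hfp]; exact tendsto_const_nhds
  have hconst' : Tendsto (fun k => (f k)⁻¹ p) atTop (𝓝 p) := by
    refine tendsto_const_nhds.congr fun k => ?_
    nth_rewrite 2 [← hfp k]
    rw [inv_apply_self]
  by_cases hb : p = b
  · subst hb
    exact ⟨hp.eq_of_isConvSeq hG hfG hf hconst, rfl⟩
  · have ha : a = p := tendsto_nhds_unique (hf.tendsto_const hb) hconst
    subst ha
    exact ⟨rfl, hp.eq_of_isConvSeq hG (fun k => G.inv_mem (hfG k)) hf.inv hconst'⟩

theorem mem_limitSet_of_conical_or_parabolic (hG : IsDiscreteConvGroup G)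
    (hp : IsConicalLimitPt G p ∨ IsBoundedParabolicPt G p) : p ∈ limitSet G := by
  rcases hp with hp | hp
  · obtain ⟨f, a, b, hfG, hinj, -, hf, -⟩ := hp.exists_isConvSeq hG
    exact mem_limitSet_of_repelling hfG hinj hf
  · exact hp.1.mem_limitSet hG

/-- No limit point is isolated. -/
theorem exists_ne_mem_of_mem_limitSet (hp : p ∈ limitSet G) {U : Set X} (hU : U ∈ 𝓝 p) :
    ∃ y ∈ U, y ≠ p := by
  obtain ⟨g, -, -, zm, hg⟩ := hp
  obtain ⟨y, hy⟩ := (Set.toFinite ({zm} : Set X)).exists_notMem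
  obtain ⟨z, hz⟩ := (Set.toFinite ({y, zm} : Set X)).exists_notMem
  rw [Set.mem_singleton_iff] at hy
  rw [Set.mem_insert_iff, Set.mem_singleton_iff, not_or] at hz
  obtain ⟨k, hk₁, hk₂⟩ := (((hg.tendsto_const hy).eventually hU).and
    ((hg.tendsto_const hz.2).eventually hU)).exists
  by_cases h : g k y = p
  · exact ⟨_, hk₂, fun h' => hz.1 ((g k).injective (h'.trans h.symm))⟩
  · exact ⟨_, hk₁, h⟩

end Metric

section Scale

variable {X : Type*} {p : Fin 3 → X}

/-- At least two of the three points `p i` lie outside `S`. -/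
def Avoids (p : Fin 3 → X) (S : Set X) : Prop := ∃ i₀, ∀ i ≠ i₀, p i ∉ S

/-- At least two of the three points `g (p i)` lie in `S`. -/
def Meets (p : Fin 3 → X) (g : X → X) (S : Set X) : Prop := ∃ i₀, ∀ i ≠ i₀, g (p i) ∈ S

theorem Avoids.mono {S T : Set X} (h : Avoids p T) (hST : S ⊆ T) : Avoids p S := by
  obtain ⟨i₀, h⟩ := h
  exact ⟨i₀, fun i hi hS => h i hi (hST hS)⟩

theorem exists_ne_of_ne (i₀ : Fin 3) : ∃ i i' : Fin 3, i ≠ i₀ ∧ i' ≠ i₀ ∧ i ≠ i' := by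
  decide +revert

theorem exists_ne_ne (i₀ i₁ : Fin 3) : ∃ i : Fin 3, i ≠ i₀ ∧ i ≠ i₁ := by
  decide +revert

theorem Meets.exists_common {g : X → X} {S T : Set X} (hS : Meets p g S) (hT : Meets p g T) :
    ∃ i, g (p i) ∈ S ∧ g (p i) ∈ T := by
  obtain ⟨i₀, hS⟩ := hS
  obtain ⟨i₁, hT⟩ := hT
  obtain ⟨i, hi₀, hi₁⟩ := exists_ne_ne i₀ i₁
  exact ⟨i, hS i hi₀, hT i hi₁⟩

variable [MetricSpace X]

theorem exists_avoids_ball (hp : Function.Injective p) :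
    ∃ δ : ℝ, 0 < δ ∧ ∀ t : X, Avoids p (Metric.ball t δ) := by
  have h : ∀ᶠ δ : ℝ in 𝓝[>] 0, ∀ i i', i ≠ i' → δ < dist (p i) (p i') / 2 := by
    rw [eventually_all]
    intro i
    rw [eventually_all]
    intro i'
    by_cases hii : i = i'
    · simp [hii]
    · filter_upwards [nhdsWithin_le_nhds
        (eventually_lt_nhds (half_pos (dist_pos.2 (hp.ne hii))))] with δ hδ _ using hδ
  obtain ⟨δ, h, hδ⟩ := (h.and self_mem_nhdsWithin).exists
  refine ⟨δ, hδ, fun t => ?_⟩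
  by_contra hav
  simp only [Avoids, not_exists, not_forall, not_not] at hav
  obtain ⟨i, -, hi⟩ := hav 0
  obtain ⟨i', hne, hi'⟩ := hav i
  have h₁ := h i' i hne
  have h₂ := dist_triangle_right (p i') (p i) t
  rw [Metric.mem_ball] at hi hi'
  linarith

variable [CompactSpace X] {G : Subgroup (X ≃ₜ X)}

theorem finite_setOf_expanding (hG : IsDiscreteConvGroup G) (hp : Function.Injective p)
    {γ ε : ℝ} (hγ : 0 < γ) (hε : 0 < ε) :
    {j | j ∈ G ∧ ∃ q s, ε ≤ dist q s ∧ ∃ i₀, ∀ i ≠ i₀,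
      γ ≤ dist (j⁻¹ (p i)) (j⁻¹ q) ∧ γ ≤ dist (j⁻¹ (p i)) (j⁻¹ s)}.Finite := by
  by_contra hinf
  set E := {j | j ∈ G ∧ ∃ q s, ε ≤ dist q s ∧ ∃ i₀, ∀ i ≠ i₀,
      γ ≤ dist (j⁻¹ (p i)) (j⁻¹ q) ∧ γ ≤ dist (j⁻¹ (p i)) (j⁻¹ s)}
  let e := Set.Infinite.natEmbedding E hinf
  obtain ⟨φ, -, a, b, h⟩ := hG (fun k => ((e k : X ≃ₜ X))⁻¹) (fun k => G.inv_mem (e k).2.1)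
    (inv_injective.comp (Subtype.val_injective.comp e.injective))
  have hE : ∀ k, ∃ q s, ε ≤ dist q s ∧ ∃ i₀, ∀ i ≠ i₀,
      γ ≤ dist ((e (φ k) : X ≃ₜ X)⁻¹ (p i)) ((e (φ k) : X ≃ₜ X)⁻¹ q) ∧
      γ ≤ dist ((e (φ k) : X ≃ₜ X)⁻¹ (p i)) ((e (φ k) : X ≃ₜ X)⁻¹ s) := fun k => (e (φ k)).2.2
  have hball := Metric.ball_mem_nhds a (half_pos hγ)
  have h₁ : ∀ᶠ k in atTop, ∀ i, p i ≠ b → (e (φ k) : X ≃ₜ X)⁻¹ (p i) ∈ Metric.ball a (γ / 2) := by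
    rw [eventually_all]
    intro i
    by_cases hi : p i = b
    · simp [hi]
    · filter_upwards [(h.tendsto_const hi).eventually_mem hball] with k hk _ using hk
  have h₂ := h.eventually (Metric.ball_mem_nhds b (half_pos hε)) hball
  obtain ⟨k, hk₁, hk₂⟩ := (h₁.and h₂).exists
  obtain ⟨q, s, hqs, i₀, hi₀⟩ := hE k
  obtain ⟨i, hi, hib⟩ : ∃ i, i ≠ i₀ ∧ p i ≠ b := by
    obtain ⟨i, i', hi, hi', hii'⟩ := exists_ne_of_ne i₀
    by_cases hib : p i = b
    · exact ⟨i', hi', fun h' => hii' (hp (hib.trans h'.symm))⟩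
    · exact ⟨i, hi, hib⟩
  have hpi := hk₁ i hib
  have key : ∀ x, γ ≤ dist ((e (φ k) : X ≃ₜ X)⁻¹ (p i)) ((e (φ k) : X ≃ₜ X)⁻¹ x) →
      dist x b < ε / 2 := by
    intro x hx
    by_contra hxb
    have h' : (e (φ k) : X ≃ₜ X)⁻¹ x ∈ Metric.ball a (γ / 2) := hk₂ x hxb
    rw [Metric.mem_ball] at h' hpi
    have := dist_triangle_right ((e (φ k) : X ≃ₜ X)⁻¹ (p i)) ((e (φ k) : X ≃ₜ X)⁻¹ x) a
    linarith
  have := dist_triangle_right q s b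
  have := key q (hi₀ i hi).1
  have := key s (hi₀ i hi).2
  linarith

/-- A sequence of radii `δ` with finite nets `net n`, such that the elements of `G` distort
the annuli `δ (i + 1) ≤ dist x t < δ i` in a controlled way. -/
structure Scale (G : Subgroup (X ≃ₜ X)) (p : Fin 3 → X) where
  /-- the radii -/
  δ : ℕ → ℝ
  /-- the nets -/
  net : ℕ → Set X
  pos : ∀ i, 0 < δ i
  lt : ∀ i, δ (i + 1) < δ i
  avoids_zero : ∀ t : X, Avoids p (Metric.ball t (δ 0))
  not_subset : ∀ (i : ℕ) (t : X), ¬Metric.ball t (δ i) ⊆ Metric.ball t (δ (i + 1))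
  not_avoids : ∀ i : ℕ, ∀ j ∈ G, ∀ t q s : X, 1 / ((i : ℝ) + 1) ≤ dist q s →
    dist (j⁻¹ q) t < δ (i + 1) → dist (j⁻¹ s) t < δ (i + 1) →
    ¬Avoids p {x | dist (j⁻¹ x) t < δ i}
  net_finite : ∀ n, (net n).Finite
  exists_mem_net : ∀ n x, ∃ t ∈ net n, x ∈ Metric.ball t (δ n)

theorem exists_next_radius (hG : IsDiscreteConvGroup G) (hp : Function.Injective p)
    (hperf : ∀ x : X, ∀ U ∈ 𝓝 x, ∃ y ∈ U, y ≠ x) (i : ℕ) {η : ℝ} (hη : 0 < η) :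
    ∃ δ : ℝ, 0 < δ ∧ δ < η ∧ (∀ t : X, ¬Metric.ball t η ⊆ Metric.ball t δ) ∧
      ∀ j ∈ G, ∀ t q s : X, 1 / ((i : ℝ) + 1) ≤ dist q s →
        dist (j⁻¹ q) t < δ → dist (j⁻¹ s) t < δ → ¬Avoids p {x | dist (j⁻¹ x) t < η} := by
  have hε : (0 : ℝ) < 1 / ((i : ℝ) + 1) := by positivity
  have hfin := finite_setOf_expanding hG hp (half_pos hη) hε
  set E := {j | j ∈ G ∧ ∃ q s, 1 / ((i : ℝ) + 1) ≤ dist q s ∧ ∃ i₀, ∀ i ≠ i₀,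
      η / 2 ≤ dist (j⁻¹ (p i)) (j⁻¹ q) ∧ η / 2 ≤ dist (j⁻¹ (p i)) (j⁻¹ s)}
  have h₁ : ∀ᶠ δ : ℝ in 𝓝[>] 0, δ < η / 2 :=
    nhdsWithin_le_nhds (eventually_lt_nhds (half_pos hη))
  have h₂ : ∀ᶠ δ : ℝ in 𝓝[>] 0, ∀ t ∈ (univ : Set X), ∃ y, dist y t < η ∧ δ < dist y t := by
    apply nhdsWithin_le_nhds
    refine isCompact_univ.eventually_forall_of_forall_eventually fun t _ => ?_
    obtain ⟨y, hy, hyt⟩ := hperf t _ (Metric.ball_mem_nhds t hη)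
    have hc₁ : Tendsto (fun z : ℝ × X => dist y z.2) (𝓝 (0, t)) (𝓝 (dist y t)) :=
      (continuous_const.dist continuous_snd).tendsto (0, t)
    have hc₂ : Tendsto (fun z : ℝ × X => z.1) (𝓝 (0, t)) (𝓝 0) :=
      continuous_fst.tendsto (0, t)
    filter_upwards [hc₁.eventually (eventually_lt_nhds hy),
      hc₂.eventually_lt hc₁ (dist_pos.2 hyt)] with z hz₁ hz₂ using ⟨y, hz₁, hz₂⟩
  have h₃ : ∀ᶠ δ : ℝ in 𝓝[>] 0, ∀ j ∈ E, ∀ x y : X, dist x y < 2 * δ →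
      dist (j x) (j y) < 1 / ((i : ℝ) + 1) := by
    rw [eventually_all_finite hfin]
    intro j _
    have huc := CompactSpace.uniformContinuous_of_continuous j.continuous
    obtain ⟨ρ, hρ, hj⟩ := Metric.uniformContinuous_iff.1 huc _ hε
    filter_upwards [nhdsWithin_le_nhds (eventually_lt_nhds (half_pos hρ))] with δ hδ x y hxy
    exact hj (by linarith)
  obtain ⟨δ, hδ₁, hδ₂, hδ₃, hδ⟩ := (h₁.and (h₂.and (h₃.and self_mem_nhdsWithin))).exists
  refine ⟨δ, hδ, by linarith, fun t hsub => ?_, fun j hj t q s hqs hq hs hav => ?_⟩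
  · obtain ⟨y, hy, hy'⟩ := hδ₂ t (mem_univ t)
    exact absurd (hsub hy) (by simpa using hy'.le)
  · by_cases hjE : j ∈ E
    · have h := hδ₃ j hjE (j⁻¹ q) (j⁻¹ s) (by
        have := dist_triangle_right (j⁻¹ q) (j⁻¹ s) t
        linarith)
      rw [apply_inv_self, apply_inv_self] at h
      linarith
    · obtain ⟨i₀, hi₀⟩ := hav
      refine hjE ⟨hj, q, s, hqs, i₀, fun i hi => ?_⟩
      have h := hi₀ i hi
      rw [mem_ofPred_eq, not_lt] at h
      have h₁ := dist_triangle (j⁻¹ (p i)) (j⁻¹ q) t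
      have h₂ := dist_triangle (j⁻¹ (p i)) (j⁻¹ s) t
      constructor <;> linarith

theorem nonempty_scale (hG : IsDiscreteConvGroup G) (hp : Function.Injective p)
    (hperf : ∀ x : X, ∀ U ∈ 𝓝 x, ∃ y ∈ U, y ≠ x) : Nonempty (Scale G p) := by
  obtain ⟨δ₀, hδ₀, h₀⟩ := exists_avoids_ball hp
  choose! F hF using fun (i : ℕ) (η : ℝ) (hη : 0 < η) => exists_next_radius hG hp hperf i hη
  let δ : ℕ → ℝ := fun n => Nat.rec δ₀ F n
  have hpos : ∀ n, 0 < δ n := fun n => by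
    induction n with
    | zero => exact hδ₀
    | succ n ih => exact (hF n _ ih).1
  have hnet : ∀ n, ∃ N : Set X, N.Finite ∧ ∀ x, ∃ t ∈ N, x ∈ Metric.ball t (δ n) := by
    intro n
    obtain ⟨N, -, hN, hcov⟩ := Metric.finite_approx_of_totallyBounded
      (isCompact_univ (X := X)).totallyBounded (δ n) (hpos n)
    exact ⟨N, hN, fun x => by simpa using hcov (mem_univ x)⟩
  choose net hfin hcov using hnet
  exact ⟨⟨δ, net, hpos, fun i => (hF i _ (hpos i)).2.1, h₀, fun i => (hF i _ (hpos i)).2.2.1,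
    fun i => (hF i _ (hpos i)).2.2.2, hfin, hcov⟩⟩

end Scale

section Gates

variable {X : Type*} [MetricSpace X]

/-- The data of the nested pair of sets `j (ball t (δ n)) ⊆ j (ball t (δ i))`. -/
structure Gate (X : Type*) [MetricSpace X] where
  /-- the group element -/
  j : X ≃ₜ X
  /-- the center -/
  t : X
  /-- the index of the outer radius -/
  i : ℕ
  /-- the index of the inner radius -/
  n : ℕ

/-- The weight of a gate: the number of consecutive annuli it is made of. -/
def Gate.weight (a : Gate X) : ℕ := a.n - a.i

variable {G : Subgroup (X ≃ₜ X)} {p : Fin 3 → X}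

namespace Scale

variable (S : Scale G p)

theorem anti : StrictAnti S.δ := strictAnti_nat_of_succ_lt S.lt

/-- The outer set of a gate. -/
def outer (a : Gate X) : Set X := {x | dist (a.j⁻¹ x) a.t < S.δ a.i}

/-- The inner set of a gate. -/
def inner (a : Gate X) : Set X := {x | dist (a.j⁻¹ x) a.t < S.δ a.n}

/-- The conditions on a gate that do not involve a group element. -/
structure IsGate (a : Gate X) : Prop where
  mem : a.j ∈ G
  mem_net : a.t ∈ S.net a.n
  lt : a.i < a.n
  avoids : Avoids p (S.outer a)

/-- `l` is a nested list of gates, each of which `g` traverses. -/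
structure IsChain (g : X ≃ₜ X) (l : List (Gate X)) : Prop where
  pairwise : l.Pairwise fun a b => S.outer b ⊆ S.inner a
  isGate : ∀ a ∈ l, S.IsGate a
  meets : ∀ a ∈ l, Meets p g (S.inner a)

/-- The total weight of a list of gates. -/
def total (l : List (Gate X)) : ℕ := (l.map Gate.weight).sum

/-- The gates whose inner set has diameter bounded below. -/
def fat (m : ℕ) : Set (Gate X) :=
  {a | S.IsGate a ∧ ∃ q ∈ S.inner a, ∃ s ∈ S.inner a, 1 / ((m : ℝ) + 1) ≤ dist q s}

variable {S}

theorem IsGate.inner_subset {a : Gate X} (ha : S.IsGate a) : S.inner a ⊆ S.outer a :=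
  fun _ hx => lt_of_lt_of_le hx (S.anti ha.lt).le

theorem IsGate.not_subset {a : Gate X} (ha : S.IsGate a) : ¬S.outer a ⊆ S.inner a := by
  intro h
  refine S.not_subset a.i a.t fun x hx => ?_
  have hx' : a.j x ∈ S.outer a := by
    rw [outer, mem_ofPred_eq, inv_apply_self]
    exact hx
  have h' := h hx'
  rw [inner, mem_ofPred_eq, inv_apply_self] at h'
  exact lt_of_lt_of_le h' (S.anti.antitone ha.lt)

/-- A gate cannot have two points at definite distance deep inside its outer set. -/
theorem IsGate.false_of_le_dist {a : Gate X} (ha : S.IsGate a) {m k : ℕ}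
    (hk : max a.i m + 1 ≤ k) {q s : X} (hqs : 1 / ((m : ℝ) + 1) ≤ dist q s)
    (hq : dist (a.j⁻¹ q) a.t < S.δ k) (hs : dist (a.j⁻¹ s) a.t < S.δ k) : False := by
  have hle := S.anti.antitone hk
  refine S.not_avoids (max a.i m) a.j ha.mem a.t q s ?_ (hq.trans_le hle) (hs.trans_le hle)
    (ha.avoids.mono fun x hx => ?_)
  · refine le_trans (one_div_le_one_div_of_le (by positivity) ?_) hqs
    gcongr
    exact le_max_right _ _
  · exact lt_of_lt_of_le hx (S.anti.antitone (le_max_left _ _))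

theorem IsChain.nodup {g : X ≃ₜ X} {l : List (Gate X)} (hl : S.IsChain g l) : l.Nodup := by
  refine hl.pairwise.imp_of_mem fun {a b} ha _ hab => ?_
  rintro rfl
  exact (hl.isGate a ha).not_subset hab

theorem total_le {l : List (Gate X)} (hl : l.Nodup) (F : Finset (Gate X)) (hF : ∀ a ∈ l, a ∈ F) :
    total l ≤ ∑ a ∈ F, a.weight := by
  classical
  rw [total, ← List.sum_toFinset _ hl]
  exact Finset.sum_le_sum_of_subset fun a ha => hF a (List.mem_toFinset.1 ha)

variable (S) in
theorem isChain_nil (g : X ≃ₜ X) : S.IsChain g [] := by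
  constructor <;> simp

open Classical in
/-- A chain can be modified, at bounded cost apart from fat gates, to avoid a set `O` at definite
distance from a set containing two of the points `s (p i)`. -/
theorem exists_trim {O K : Set X} {m : ℕ} {s : X ≃ₜ X}
    (hOK : ∀ q ∈ O, ∀ x ∈ K, 1 / ((m : ℝ) + 1) ≤ dist q x) (hK : Meets p s K)
    {l : List (Gate X)} (hl : S.IsChain s l) :
    ∃ l₁, S.IsChain s l₁ ∧ (∀ a ∈ l₁, Disjoint (S.outer a) O) ∧
      total l ≤ total l₁ + total (l.filter (· ∈ S.fat m)) + (m + 1) := by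
  induction l with
  | nil => exact ⟨[], hl, by simp, by simp [total]⟩
  | cons a l ih =>
    have hl' : S.IsChain s l := ⟨hl.pairwise.of_cons, fun b hb => hl.isGate b (by simp [hb]),
      fun b hb => hl.meets b (by simp [hb])⟩
    have hsub : ∀ b ∈ l, S.outer b ⊆ S.inner a := (List.pairwise_cons.1 hl.pairwise).1
    have ha : S.IsGate a := hl.isGate a (by simp)
    have hsa : Meets p s (S.inner a) := hl.meets a (by simp)
    obtain ⟨i, hia, hiK⟩ := hsa.exists_common hK
    have hcons : total (a :: l) = a.weight + total l := rfl
    by_cases hbad : ∃ b ∈ l, ¬Disjoint (S.outer b) O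
    · obtain ⟨b, hb, hbO⟩ := hbad
      obtain ⟨q, hqb, hqO⟩ := not_disjoint_iff.1 hbO
      have hfat : a ∈ S.fat m := ⟨ha, q, hsub b hb hqb, _, hia, hOK q hqO _ hiK⟩
      obtain ⟨l₁, h₁, h₂, h₃⟩ := ih hl'
      refine ⟨l₁, h₁, h₂, ?_⟩
      rw [List.filter_cons_of_pos (by simpa using hfat), hcons]
      have : total (a :: l.filter (· ∈ S.fat m)) = a.weight + total (l.filter (· ∈ S.fat m)) := rfl
      omega
    · push Not at hbad
      by_cases hn : max a.i m + 1 < a.n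
      · let a' : Gate X := ⟨a.j, a.t, max a.i m + 1, a.n⟩
        have hout : S.outer a' ⊆ S.outer a := fun x hx =>
          lt_of_lt_of_le hx (S.anti.antitone (by simp only [a']; omega))
        have ha' : S.IsGate a' := ⟨ha.mem, ha.mem_net, hn, ha.avoids.mono hout⟩
        refine ⟨a' :: l, ⟨List.pairwise_cons.2 ⟨hsub, hl'.pairwise⟩, ?_, ?_⟩, ?_, ?_⟩
        · exact List.forall_mem_cons.2 ⟨ha', hl'.isGate⟩
        · exact List.forall_mem_cons.2 ⟨hsa, hl'.meets⟩
        · refine List.forall_mem_cons.2 ⟨?_, hbad⟩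
          rw [Set.disjoint_left]
          intro q hq hqO
          exact ha.false_of_le_dist le_rfl (hOK q hqO _ hiK) hq (ha'.inner_subset hia)
        · have hcons' : total (a' :: l) = a'.weight + total l := rfl
          simp only [hcons, hcons', Gate.weight, a']
          omega
      · refine ⟨l, hl', hbad, ?_⟩
        rw [hcons, Gate.weight]
        omega

variable [CompactSpace X]

theorem finite_fat (hG : IsDiscreteConvGroup G) (hp : Function.Injective p) (m : ℕ) :
    (S.fat m).Finite := by
  have hm : (0 : ℝ) < 1 / ((m : ℝ) + 1) := by positivity
  refine ((finite_Iic m).biUnion (t := fun n => ⋃ i ∈ Iio n, ⋃ t ∈ S.net n,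
    (fun j => Gate.mk j t i n) '' {j | j ∈ G ∧ ∃ q s, 1 / ((m : ℝ) + 1) ≤ dist q s ∧
      ∃ i₀, ∀ k ≠ i₀, S.δ i - S.δ n ≤ dist (j⁻¹ (p k)) (j⁻¹ q) ∧
        S.δ i - S.δ n ≤ dist (j⁻¹ (p k)) (j⁻¹ s)}) fun n _ =>
    (finite_Iio n).biUnion fun i hi => (S.net_finite n).biUnion fun t _ =>
      (finite_setOf_expanding hG hp (sub_pos.2 (S.anti hi)) hm).image _).subset ?_
  rintro ⟨j, t, i, n⟩ ⟨ha, q, hq, s, hs, hqs⟩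
  have hnm : n ≤ m := by
    by_contra hnm
    refine ha.false_of_le_dist (k := n) ?_ hqs hq hs
    have := ha.lt
    simp only at this ⊢
    omega
  obtain ⟨i₀, hi₀⟩ := ha.avoids
  simp only [mem_iUnion, mem_image, mem_Iic, mem_Iio]
  refine ⟨n, hnm, i, ha.lt, t, ha.mem_net, j, ⟨ha.mem, q, s, hqs, i₀, fun k hk => ?_⟩, rfl⟩
  have h := hi₀ k hk
  simp only [outer, inner, mem_ofPred_eq, not_lt] at h hq hs
  have h₁ := dist_triangle (j⁻¹ (p k)) (j⁻¹ q) t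
  have h₂ := dist_triangle (j⁻¹ (p k)) (j⁻¹ s) t
  constructor <;> linarith

theorem bddAbove_total (hG : IsDiscreteConvGroup G) (hp : Function.Injective p) (g : X ≃ₜ X) :
    BddAbove {w | ∃ l, S.IsChain g l ∧ total l = w} := by
  obtain ⟨m, hm⟩ : ∃ m : ℕ, ∀ i i', i ≠ i' → 1 / ((m : ℝ) + 1) ≤ dist (g (p i)) (g (p i')) := by
    have h : ∀ᶠ m : ℕ in atTop, ∀ i i', i ≠ i' →
        1 / ((m : ℝ) + 1) ≤ dist (g (p i)) (g (p i')) := by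
      rw [eventually_all]
      intro i
      rw [eventually_all]
      intro i'
      by_cases hii : i = i'
      · simp [hii]
      · filter_upwards [tendsto_one_div_add_atTop_nhds_zero_nat.eventually
          (eventually_le_nhds (dist_pos.2 ((g.injective.comp hp).ne hii)))] with m hm _ using hm
    exact h.exists
  refine ⟨∑ a ∈ (finite_fat (S := S) hG hp m).toFinset, a.weight, ?_⟩
  rintro w ⟨l, hl, rfl⟩
  refine total_le hl.nodup _ fun a ha => ?_
  rw [Set.Finite.mem_toFinset]
  obtain ⟨i₀, hi₀⟩ := hl.meets a ha
  obtain ⟨i, i', hi, hi', hne⟩ := exists_ne_of_ne i₀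
  exact ⟨hl.isGate a ha, _, hi₀ i hi, _, hi₀ i' hi', hm i i' hne⟩

variable (S) in
/-- The maximal total weight of a chain of gates traversed by `g`. -/
noncomputable def value (g : X ≃ₜ X) : ℕ := sSup {w | ∃ l, S.IsChain g l ∧ total l = w}

theorem IsChain.total_le_value (hG : IsDiscreteConvGroup G) (hp : Function.Injective p)
    {g : X ≃ₜ X} {l : List (Gate X)} (hl : S.IsChain g l) : total l ≤ S.value g :=
  le_csSup (bddAbove_total hG hp g) ⟨l, hl, rfl⟩

variable (S) in
theorem exists_total_eq_value (hG : IsDiscreteConvGroup G) (hp : Function.Injective p)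
    (g : X ≃ₜ X) : ∃ l, S.IsChain g l ∧ total l = S.value g :=
  Nat.sSup_mem (s := {w | ∃ l, S.IsChain g l ∧ total l = w}) ⟨0, [], S.isChain_nil g, rfl⟩
    (bddAbove_total hG hp g)

/-- If `h` maps the complement of a ball of radius `δ n` close to a point, then multiplication
by `h` decreases the value by `n` up to a constant. -/
theorem exists_value_add_le (hG : IsDiscreteConvGroup G) (hp : Function.Injective p)
    {O K : Set X} {m : ℕ} (hOK : ∀ q ∈ O, ∀ x ∈ K, 1 / ((m : ℝ) + 1) ≤ dist q x) :
    ∃ L : ℕ, ∀ n > 0, ∀ t ∈ S.net n, ∀ h ∈ G, ∀ g : X ≃ₜ X,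
      (∀ x ∉ Metric.ball t (S.δ n), h x ∈ O) → Meets p g (Metric.ball t (S.δ n)) →
      Meets p (h * g) K → S.value (h * g) + n ≤ S.value g + L := by
  classical
  refine ⟨∑ a ∈ (finite_fat (S := S) hG hp m).toFinset, a.weight + (m + 1), ?_⟩
  intro n hn t ht h hh g hhO hgt hK
  obtain ⟨l, hl, hlv⟩ := S.exists_total_eq_value hG hp (h * g)
  obtain ⟨l₁, hl₁, hdisj, hle⟩ := exists_trim hOK hK hl
  have hfat := total_le (hl.nodup.filter (· ∈ S.fat m)) (finite_fat hG hp m).toFinset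
    (fun a ha => by simpa using (List.mem_filter.1 ha).2)
  let a₀ : Gate X := ⟨1, t, 0, n⟩
  let T : Gate X → Gate X := fun a => ⟨h⁻¹ * a.j, a.t, a.i, a.n⟩
  have hout : ∀ a, S.outer (T a) = h ⁻¹' S.outer a := fun a => by
    ext x
    simp only [outer, T, mem_ofPred_eq, mem_preimage, mul_inv_rev, inv_inv, mul_apply]
  have hinn : ∀ a, S.inner (T a) = h ⁻¹' S.inner a := fun a => by
    ext x
    simp only [inner, T, mem_ofPred_eq, mem_preimage, mul_inv_rev, inv_inv, mul_apply]
  have hout₀ : S.outer a₀ = Metric.ball t (S.δ 0) := by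
    ext x
    simp only [outer, a₀, mem_ofPred_eq, inv_one, one_apply, Metric.mem_ball]
  have hinn₀ : S.inner a₀ = Metric.ball t (S.δ n) := by
    ext x
    simp only [inner, a₀, mem_ofPred_eq, inv_one, one_apply, Metric.mem_ball]
  have hball : ∀ a ∈ l₁, S.outer (T a) ⊆ Metric.ball t (S.δ n) := by
    intro a ha x hx
    by_contra hxt
    rw [hout] at hx
    exact Set.disjoint_left.1 (hdisj a ha) hx (hhO x hxt)
  have hchain : S.IsChain g (a₀ :: l₁.map T) := by
    refine ⟨List.pairwise_cons.2 ⟨?_, ?_⟩, List.forall_mem_cons.2 ⟨?_, ?_⟩,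
      List.forall_mem_cons.2 ⟨?_, ?_⟩⟩
    · rw [List.forall_mem_map]
      intro a ha
      rw [hinn₀]
      exact hball a ha
    · rw [List.pairwise_map]
      refine hl₁.pairwise.imp fun {a b} hab => ?_
      rw [hout, hinn]
      exact preimage_mono hab
    · exact ⟨G.one_mem, ht, hn, hout₀ ▸ S.avoids_zero t⟩
    · rw [List.forall_mem_map]
      intro a ha
      have hga := hl₁.isGate a ha
      refine ⟨G.mul_mem (G.inv_mem hh) hga.mem, hga.mem_net, hga.lt,
        (S.avoids_zero t).mono ((hball a ha).trans (Metric.ball_subset_ball ?_))⟩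
      exact S.anti.antitone (Nat.zero_le n)
    · rwa [hinn₀]
    · rw [List.forall_mem_map]
      intro a ha
      rw [hinn]
      exact hl₁.meets a ha
  have htot : total (a₀ :: l₁.map T) = n + total l₁ := by
    simp only [total, List.map_cons, List.sum_cons, List.map_map]
    rfl
  have := hchain.total_le_value hG hp
  omega

end Scale

end Gates

section OneSided

variable {X : Type*} [MetricSpace X] [CompactSpace X]
  {G J : Subgroup (X ≃ₜ X)} {p : Fin 3 → X}

theorem IsConvSeq.eventually_meets (hp : Function.Injective p) {u : ℕ → X ≃ₜ X} {zp zm : X}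
    (hu : IsConvSeq u zp zm) {W : Set X} (hW : W ∈ 𝓝 zp) : ∀ᶠ k in atTop, Meets p (u k) W := by
  obtain ⟨i₀, hi₀⟩ : ∃ i₀, ∀ i ≠ i₀, p i ≠ zm := by
    by_cases h : ∃ i, p i = zm
    · obtain ⟨i₀, rfl⟩ := h
      exact ⟨i₀, fun i hi => hp.ne hi⟩
    · exact ⟨0, fun i _ hi => h ⟨i, hi⟩⟩
  have h : ∀ᶠ k in atTop, ∀ i, i ≠ i₀ → u k (p i) ∈ W := by
    rw [eventually_all]
    intro i
    by_cases hi : i = i₀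
    · simp [hi]
    · filter_upwards [(hu.tendsto_const (hi₀ i hi)).eventually_mem hW] with k hk _ using hk
  exact h.mono fun k hk => ⟨i₀, hk⟩

variable [Infinite X]

/-- The stabilizer in `J` of a parabolic point of a fully quasi-convex subgroup `J` acts
cocompactly on the complement of this point. -/
theorem IsFullyQuasiconvex.exists_isCompact (hG : IsDiscreteConvGroup G)
    (hGM : ∀ x : X, IsConicalLimitPt G x ∨ IsBoundedParabolicPt G x)
    (hqc : IsFullyQuasiconvex G J) {c : X} (hc : IsParabolicPt J c) :
    ∃ K : Set X, IsCompact K ∧ c ∉ K ∧ ∀ x ≠ c, ∃ h ∈ J, h c = c ∧ h x ∈ K := by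
  classical
  obtain ⟨hJG, -, F, hF, hFJ⟩ := hqc
  have hcJ : c ∈ limitSet J := hc.mem_limitSet (hG.mono hJG)
  obtain ⟨q, hqJ, hq⟩ := hc
  have hcG : IsParabolicPt G c := ⟨q, hJG hqJ, hq⟩
  obtain ⟨-, K, hK, hKc, hKx⟩ := (hGM c).resolve_left (hcG.not_isConicalLimitPt hG)
  have hrep : ∀ f : X ≃ₜ X, ∃ r : X ≃ₜ X, r c = c ∧
      ∀ h ∈ G, h c = c → (∃ j ∈ J, h = f * j) → r⁻¹ * h ∈ J := by
    intro f
    by_cases hf : ∃ h ∈ G, h c = c ∧ ∃ j ∈ J, h = f * j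
    · obtain ⟨r, -, hrc, j, hj, rfl⟩ := hf
      refine ⟨f * j, hrc, ?_⟩
      rintro _ - - ⟨j', hj', rfl⟩
      rw [mul_inv_rev, mul_assoc, inv_mul_cancel_left]
      exact J.mul_mem (J.inv_mem hj) hj'
    · exact ⟨1, rfl, fun h hh hhc hj => absurd ⟨h, hh, hhc, hj⟩ hf⟩
  choose r hrc hr using hrep
  have hrc' : ∀ f, (r f)⁻¹ c = c := fun f => by
    nth_rewrite 1 [← hrc f]
    exact inv_apply_self _ _
  refine ⟨⋃ f ∈ F, ⇑(r f)⁻¹ '' K, hF.isCompact_biUnion fun f _ => hK.image (r f)⁻¹.continuous,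
    ?_, fun x hx => ?_⟩
  · simp only [mem_iUnion, mem_image, not_exists, not_and]
    intro f _ x hxK hxc
    exact (hKc hxK).2 ((r f)⁻¹.injective (hxc.trans (hrc' f).symm))
  · obtain ⟨h, hh, hhc, hhx⟩ := hKx x ⟨mem_limitSet_of_conical_or_parabolic hG (hGM x), hx⟩
    obtain ⟨f, hf, j, hj, hfj⟩ := hFJ h hh ⟨c, ⟨c, hcJ, hhc⟩, hcJ⟩
    refine ⟨(r f)⁻¹ * h, hr f h hh hhc ⟨j, hj, hfj⟩, ?_, ?_⟩
    · rw [mul_apply, hhc, hrc']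
    · exact mem_iUnion₂.2 ⟨f, hf, h x, hhx, rfl⟩

/-- A sequence converging to a parabolic point `c` of a fully quasi-convex subgroup `J` can be
pushed away from `c` by the stabilizer of `c` in `J`, after passing to a subsequence. -/
theorem exists_stabilizer_meets (hG : IsDiscreteConvGroup G)
    (hGM : ∀ x : X, IsConicalLimitPt G x ∨ IsBoundedParabolicPt G x)
    (hqc : IsFullyQuasiconvex G J) (hp : Function.Injective p) {c : X} (hc : IsParabolicPt J c)
    {u : ℕ → X ≃ₜ X} (hu : ∀ k, u k ∈ G) :
    ∃ (φ : ℕ → ℕ) (h : ℕ → X ≃ₜ X) (K : Set X), StrictMono φ ∧ (∀ k, h k ∈ J) ∧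
      (∀ k, h k c = c) ∧ IsClosed K ∧ c ∉ K ∧ ∀ᶠ k in atTop, Meets p (h k * u (φ k)) K := by
  have hJG := hqc.1
  have hcG : IsParabolicPt G c := by
    obtain ⟨q, hqJ, hq⟩ := hc
    exact ⟨q, hJG hqJ, hq⟩
  obtain ⟨K, hK, hcK, hKx⟩ := hqc.exists_isCompact hG hGM hc
  obtain ⟨y, φ, hφ, hy⟩ := CompactSpace.tendsto_subseq fun k => (u k)⁻¹ c
  obtain ⟨i, hi⟩ : ∃ i, p i ≠ y := by
    by_contra! h
    exact absurd (hp ((h 0).trans (h 1).symm)) (by decide)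
  obtain ⟨ψ, hψ, hψy⟩ := extraction_of_eventually_atTop (hy.eventually_ne hi.symm)
  have hne : ∀ k, u (φ (ψ k)) (p i) ≠ c := by
    intro k hk
    apply hψy k
    simp only [Function.comp]
    rw [← hk, inv_apply_self]
  choose h hhJ hhc hhK using fun k => hKx _ (hne k)
  have hhc' : ∀ k, (h k)⁻¹ c = c := fun k => by
    nth_rewrite 1 [← hhc k]
    exact inv_apply_self _ _
  obtain ⟨θ, hθ, hs⟩ := hG.exists_subseq (u := fun k => h k * u (φ (ψ k)))
    fun k => G.mul_mem (hJG (hhJ k)) (hu _)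
  suffices hs' : ∃ K' : Set X, IsClosed K' ∧ c ∉ K' ∧
      ∀ᶠ k in atTop, Meets p (h (θ k) * u (φ (ψ (θ k)))) K' by
    obtain ⟨K', h₁, h₂, h₃⟩ := hs'
    exact ⟨φ ∘ ψ ∘ θ, h ∘ θ, K', hφ.comp (hψ.comp hθ), fun k => hhJ _, fun k => hhc _, h₁, h₂, h₃⟩
  rcases hs with ⟨s, hs⟩ | ⟨-, z, w, hs⟩
  · obtain ⟨i₀, hi₀⟩ : ∃ i₀, ∀ i ≠ i₀, s (p i) ≠ c := by
      by_cases h : ∃ i, s (p i) = c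
      · obtain ⟨i₀, rfl⟩ := h
        exact ⟨i₀, fun i hi => (s.injective.comp hp).ne hi⟩
      · exact ⟨0, fun i _ hi => h ⟨i, hi⟩⟩
    refine ⟨(fun i => s (p i)) '' {i | i ≠ i₀}, (Set.toFinite _).isClosed, ?_, ?_⟩
    · rintro ⟨i, hi, hic⟩
      exact hi₀ i hi hic
    · refine Eventually.of_forall fun k => ?_
      rw [hs k]
      exact ⟨i₀, fun i hi => ⟨i, hi, rfl⟩⟩
  · have hzc : z ≠ c := by
      rintro rfl
      by_cases hw : p i = w
      · subst hw
        refine hi (hcG.eq_of_isConvSeq hG (fun k => G.inv_mem ?_) hs.inv ?_)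
        · exact G.mul_mem (hJG (hhJ _)) (hu _)
        · refine (hy.comp (hψ.comp hθ).tendsto_atTop).congr fun k => ?_
          simp only [Function.comp, mul_inv_rev, mul_apply, hhc']
      · exact hcK (hK.isClosed.mem_of_tendsto (hs.tendsto_const hw)
          (Eventually.of_forall fun k => hhK _))
    have hd := dist_pos.2 hzc.symm
    refine ⟨Metric.closedBall z (dist c z / 2), Metric.isClosed_closedBall, ?_,
      hs.eventually_meets hp (Metric.closedBall_mem_nhds z (half_pos hd))⟩
    rw [Metric.mem_closedBall]
    linarith

/-- A convergence sequence in `G` whose attracting point lies in the limit set of a fully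
quasi-convex subgroup `J` is expanded near this point by elements of `J`. -/
theorem exists_expanding (hG : IsDiscreteConvGroup G)
    (hGM : ∀ x : X, IsConicalLimitPt G x ∨ IsBoundedParabolicPt G x)
    (hqc : IsFullyQuasiconvex G J) (hp : Function.Injective p)
    {u : ℕ → X ≃ₜ X} (hu : ∀ k, u k ∈ G) {zp zm : X} (hconv : IsConvSeq u zp zm)
    (hzp : zp ∈ limitSet J) :
    ∃ (a : X) (K : Set X), IsClosed K ∧ a ∉ K ∧ ∀ O ∈ 𝓝 a, ∀ V ∈ 𝓝 zp, ∃ k, ∃ h ∈ J,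
      (∀ x ∉ V, h x ∈ O) ∧ Meets p (u k) V ∧ Meets p (h * u k) K := by
  have hJG := hqc.1
  rcases hqc.2.1 zp hzp with hcon | hpar
  · obtain ⟨f, a, b, hfJ, -, hab, hf, hfb⟩ := hcon.exists_isConvSeq (hG.mono hJG)
    have hd := dist_pos.2 hab
    have hKb := Metric.ball_mem_nhds b (half_pos hd)
    refine ⟨a, Metric.closedBall b (dist a b / 2), Metric.isClosed_closedBall, ?_, ?_⟩
    · rw [Metric.mem_closedBall]
      linarith
    intro O hO V hV
    obtain ⟨l, hl₁, hl₂⟩ := ((hf.eventually hV hO).and (hfb.eventually_mem hKb)).exists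
    have hW : V ∩ f l ⁻¹' Metric.closedBall b (dist a b / 2) ∈ 𝓝 zp :=
      inter_mem hV ((f l).continuous.continuousAt (mem_of_superset
        (Metric.isOpen_ball.mem_nhds hl₂) Metric.ball_subset_closedBall))
    obtain ⟨k, i₀, hk⟩ := (hconv.eventually_meets hp hW).exists
    exact ⟨k, f l, hfJ l, hl₁, ⟨i₀, fun i hi => (hk i hi).1⟩, ⟨i₀, fun i hi => (hk i hi).2⟩⟩
  · have hcG : IsParabolicPt G zp := by
      obtain ⟨q, hqJ, hq⟩ := hpar.1
      exact ⟨q, hJG hqJ, hq⟩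
    obtain ⟨φ, h, K, hφ, hhJ, hhc, hK, hcK, hmeets⟩ :=
      exists_stabilizer_meets hG hGM hqc hp hpar.1 hu
    obtain ⟨ψ, hψ, hh⟩ := hG.exists_subseq fun k => hJG (hhJ k)
    replace hconv := hconv.comp (hφ.comp hψ).tendsto_atTop
    replace hmeets := hψ.tendsto_atTop.eventually hmeets
    rcases hh with ⟨c, hc⟩ | ⟨-, α, β, hh⟩
    · have h₁ := hconv.const_mul c
      have hcz : c zp = zp := by rw [← hc 0, hhc]
      rw [hcz] at h₁
      obtain ⟨k, hk₁, hk₂⟩ :=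
        (hmeets.and (h₁.eventually_meets hp (hK.isOpen_compl.mem_nhds hcK))).exists
      rw [hc k] at hk₁
      obtain ⟨i, hi₁, hi₂⟩ := hk₁.exists_common hk₂
      exact absurd hi₁ hi₂
    · obtain ⟨rfl, hβ⟩ := hcG.eq_of_stabilizer hG (fun k => hJG (hhJ (ψ k))) (fun k => hhc _) hh
      subst hβ
      refine ⟨_, K, hK, hcK, fun O hO V hV => ?_⟩
      obtain ⟨k, hk₁, hk₂, hk₃⟩ := ((hh.eventually hV hO).and
        ((hconv.eventually_meets hp hV).and hmeets)).exists
      exact ⟨_, _, hhJ (ψ k), hk₁, hk₂, hk₃⟩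

/-- Left multiplication by elements of a fully quasi-convex subgroup `J` can remove all attracting
points in the limit set of `J`. -/
theorem exists_attracting_notMem (hG : IsDiscreteConvGroup G)
    (hGM : ∀ x : X, IsConicalLimitPt G x ∨ IsBoundedParabolicPt G x)
    (hqc : IsFullyQuasiconvex G J) {g : ℕ → X ≃ₜ X} (hg : ∀ k, g k ∈ G) :
    ∃ j : ℕ → X ≃ₜ X, (∀ k, j k ∈ J) ∧ ∀ φ : ℕ → ℕ, StrictMono φ → ∀ zp zm : X,
      IsConvSeq (fun k => j (φ k) * g (φ k)) zp zm → zp ∉ limitSet J := by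
  have hJG := hqc.1
  let p : Fin 3 → X := fun i => Infinite.natEmbedding X i
  have hp : Function.Injective p := (Infinite.natEmbedding X).injective.comp Fin.val_injective
  obtain ⟨S⟩ := nonempty_scale hG hp fun x _ hU =>
    exists_ne_mem_of_mem_limitSet (mem_limitSet_of_conical_or_parabolic hG (hGM x)) hU
  have hmin : ∀ k, ∃ j ∈ J, ∀ j' ∈ J, S.value (j * g k) ≤ S.value (j' * g k) := fun k =>
    ⟨Function.argminOn (fun j => S.value (j * g k)) (J : Set (X ≃ₜ X)) ⟨1, J.one_mem⟩,
      Function.argminOn_mem _ _ _, fun j' hj' => Function.argminOn_le (fun j => S.value (j * g k)) _ hj'⟩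
  choose j hjJ hj using hmin
  refine ⟨j, hjJ, fun φ _ zp zm hconv hzp => ?_⟩
  obtain ⟨a, K, hK, haK, hexp⟩ := exists_expanding hG hGM hqc hp
    (fun k => G.mul_mem (hJG (hjJ (φ k))) (hg (φ k))) hconv hzp
  obtain ⟨ε, hε, hεK⟩ := Metric.isOpen_iff.1 hK.isOpen_compl a haK
  obtain ⟨m, hm⟩ := exists_nat_one_div_lt (half_pos hε)
  obtain ⟨L, hL⟩ := Scale.exists_value_add_le (S := S) hG hp (O := Metric.ball a (ε / 2))
    (K := K) (m := m) (fun q hq x hx => by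
      have hx' : ε ≤ dist x a := by
        by_contra hlt
        exact hεK (not_le.1 hlt) hx
      rw [Metric.mem_ball] at hq
      have := dist_triangle_left x a q
      linarith)
  obtain ⟨t, ht, hzt⟩ := S.exists_mem_net (L + 1) zp
  obtain ⟨k, h, hh, h₁, h₂, h₃⟩ := hexp _ (Metric.ball_mem_nhds a (half_pos hε)) _
    (Metric.isOpen_ball.mem_nhds hzt)
  have h₄ := hL (L + 1) L.succ_pos t ht h (hJG hh) _ h₁ h₂ h₃
  have h₅ := hj (φ k) (h * j (φ k)) (J.mul_mem hh (hjJ _))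
  rw [mul_assoc] at h₅
  omega

/-- Left and right multiplication by elements of fully quasi-convex subgroups can remove all
attracting and repelling points in the respective limit sets. -/
theorem exists_attracting_repelling_notMem {J₁ J₂ : Subgroup (X ≃ₜ X)}
    (hG : IsDiscreteConvGroup G)
    (hGM : ∀ x : X, IsConicalLimitPt G x ∨ IsBoundedParabolicPt G x)
    (hqc₁ : IsFullyQuasiconvex G J₁) (hqc₂ : IsFullyQuasiconvex G J₂)
    {g : ℕ → X ≃ₜ X} (hg : ∀ k, g k ∈ G) :
    ∃ j j' : ℕ → X ≃ₜ X, (∀ k, j k ∈ J₁) ∧ (∀ k, j' k ∈ J₂) ∧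
      ∀ φ : ℕ → ℕ, StrictMono φ → ∀ zp zm : X,
        IsConvSeq (fun k => j (φ k) * g (φ k) * j' (φ k)) zp zm →
        zp ∉ limitSet J₁ ∧ zm ∉ limitSet J₂ := by
  obtain ⟨j, hjJ, hj⟩ := exists_attracting_notMem hG hGM hqc₁ hg
  obtain ⟨i, hiJ, hi⟩ := exists_attracting_notMem hG hGM hqc₂
    (fun k => G.inv_mem (G.mul_mem (hqc₁.1 (hjJ k)) (hg k)))
  refine ⟨j, fun k => (i k)⁻¹, hjJ, fun k => J₂.inv_mem (hiJ k), fun φ hφ zp zm hconv => ?_⟩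
  have hzm : zm ∉ limitSet J₂ := by
    refine hi φ hφ zm zp ?_
    simpa only [mul_inv_rev, inv_inv] using hconv.inv
  refine ⟨?_, hzm⟩
  obtain ⟨ψ, hψ, hv⟩ := (hG.mono hqc₂.1).exists_subseq fun k => hiJ (φ k)
  replace hconv := hconv.comp hψ.tendsto_atTop
  rcases hv with ⟨c, hc⟩ | ⟨hinj, α, β, hv⟩
  · refine hj (φ ∘ ψ) (hφ.comp hψ) zp (c⁻¹ zm) ?_
    have h := hconv.mul_const c
    have heq : (fun k => j ((φ ∘ ψ) k) * g ((φ ∘ ψ) k)) =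
        fun k => ((fun k => j (φ k) * g (φ k) * (i (φ k))⁻¹) ∘ ψ) k * c := by
      funext k
      simp only [Function.comp, hc, inv_mul_cancel_right]
    rwa [heq]
  · refine hj (φ ∘ ψ) (hφ.comp hψ) zp β ?_
    have hα : α ∈ limitSet J₂ := ⟨_, fun k => hiJ _, hinj, β, hv⟩
    have h := hconv.mul hv fun h => hzm (h ▸ hα)
    have heq : (fun k => j ((φ ∘ ψ) k) * g ((φ ∘ ψ) k)) =
        fun k => ((fun k => j (φ k) * g (φ k) * (i (φ k))⁻¹) ∘ ψ) k *
          ((fun k => i (φ k)) ∘ ψ) k := by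
      funext k
      simp only [Function.comp, inv_mul_cancel_right]
    rwa [heq]

end OneSided

/-- Let `G` be a discrete convergence group acting on a compact metrizable
space `M` such that every point of `M` is a conical limit point or a bounded parabolic
point for `G` (so `G` is geometrically finite with `Λ(G) = M`), and let `J₁, J₂` be fully
quasi-convex subgroups of `G`. Then for any sequence `(g k)` in `G` there are `j k ∈ J₁`
and `j' k ∈ J₂` such that the sequence `(j k * g k * j' k)` has no attracting points in
`Λ(J₁)` and no repelling points in `Λ(J₂)`: no convergence subsequence has its attracting
point in `Λ(J₁)` or its repelling point in `Λ(J₂)`. -/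
theorem statement_2 {M : Type*} [TopologicalSpace M] [CompactSpace M]
    [TopologicalSpace.MetrizableSpace M]
    (G : Subgroup (M ≃ₜ M)) (hG : IsDiscreteConvGroup G)
    (hGM : ∀ x : M, IsConicalLimitPt G x ∨ IsBoundedParabolicPt G x)
    (J₁ J₂ : Subgroup (M ≃ₜ M))
    (hqc₁ : IsFullyQuasiconvex G J₁) (hqc₂ : IsFullyQuasiconvex G J₂)
    (g : ℕ → M ≃ₜ M) (hg : ∀ k, g k ∈ G) :
    ∃ j j' : ℕ → M ≃ₜ M, (∀ k, j k ∈ J₁) ∧ (∀ k, j' k ∈ J₂) ∧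
      ∀ φ : ℕ → ℕ, StrictMono φ → ∀ zp zm : M,
        IsConvSeq (fun k => j (φ k) * g (φ k) * j' (φ k)) zp zm →
        zp ∉ limitSet J₁ ∧ zm ∉ limitSet J₂ := by
  let _ : MetricSpace M := TopologicalSpace.metrizableSpaceMetric M
  rcases finite_or_infinite M with hM | hM
  · refine ⟨1, 1, fun _ => J₁.one_mem, fun _ => J₂.one_mem, fun φ _ zp zm _ => ?_⟩
    rw [limitSet_eq_empty, limitSet_eq_empty]
    exact ⟨notMem_empty _, notMem_empty _⟩
  · exact exists_attracting_repelling_notMem hG hGM hqc₁ hqc₂ hg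

end ConvergenceGroups
end

section
/- Let G₀ be a discrete convergence group acting on a compact metrizable space M, let J₁, J₋₁ ≤ G₀ be geometrically finite subgroups, and let f ∈ Homeo(M) generate an infinite cyclic discrete convergence group with f J₋₁ f⁻¹ = J₁. Suppose G₀ is in HNN ping-pong position with respect to f, J₁ and J₋₁. Let G = ⟨G₀, f⟩ ≤ Homeo(M) and suppose G acts on M as a convergence group. Then G is a discrete convergence group; equivalently, G is a discrete subgroup of Homeo(M) in the compact-open topology. -/
open Filter Topology Set

namespace ConvergenceGroups

variable {M : Type*} [TopologicalSpace M]

/-- Elements of `⟨G₀, f⟩` represented by a reduced HNN word whose first letter is `f`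
(index `true`) or `f⁻¹` (index `false`). -/
inductive HNNReduced (G₀ J₁ Jm : Subgroup (M ≃ₜ M)) (f : M ≃ₜ M) : Bool → (M ≃ₜ M) → Prop
  | pos_base {y : M ≃ₜ M} : y ∈ G₀ → HNNReduced G₀ J₁ Jm f true (f * y)
  | neg_base {y : M ≃ₜ M} : y ∈ G₀ → HNNReduced G₀ J₁ Jm f false (f⁻¹ * y)
  | pos_step {ε : Bool} {h x : M ≃ₜ M} : h ∈ G₀ → HNNReduced G₀ J₁ Jm f ε x →
      ¬(ε = false ∧ h ∈ Jm) → HNNReduced G₀ J₁ Jm f true (f * (h * x))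
  | neg_step {ε : Bool} {h x : M ≃ₜ M} : h ∈ G₀ → HNNReduced G₀ J₁ Jm f ε x →
      ¬(ε = true ∧ h ∈ J₁) → HNNReduced G₀ J₁ Jm f false (f⁻¹ * (h * x))

/-- Elements of `G₀`, or of the form `h * x` with `h ∈ G₀` and `x` reduced. -/
def HasHNNForm (G₀ J₁ Jm : Subgroup (M ≃ₜ M)) (f g : M ≃ₜ M) : Prop :=
  g ∈ G₀ ∨ ∃ h ∈ G₀, ∃ ε x, HNNReduced G₀ J₁ Jm f ε x ∧ g = h * x

section NormalForm

variable {G₀ J₁ Jm : Subgroup (M ≃ₜ M)} {f : M ≃ₜ M}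

theorem HNNReduced.hasHNNForm {ε : Bool} {x : M ≃ₜ M} (hx : HNNReduced G₀ J₁ Jm f ε x) :
    HasHNNForm G₀ J₁ Jm f x :=
  Or.inr ⟨1, G₀.one_mem, ε, x, hx, (one_mul x).symm⟩

theorem HasHNNForm.mul_left {g y : M ≃ₜ M} (hy : y ∈ G₀) (hg : HasHNNForm G₀ J₁ Jm f g) :
    HasHNNForm G₀ J₁ Jm f (y * g) := by
  rcases hg with hg | ⟨h, hh, ε, x, hx, rfl⟩
  · exact Or.inl (G₀.mul_mem hy hg)
  · exact Or.inr ⟨y * h, G₀.mul_mem hy hh, ε, x, hx, (mul_assoc _ _ _).symm⟩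

theorem HasHNNForm.stable_mul (hJ₁G₀ : J₁ ≤ G₀)
    (hconj : ∀ x : M ≃ₜ M, x ∈ J₁ ↔ f⁻¹ * x * f ∈ Jm) {g : M ≃ₜ M}
    (hg : HasHNNForm G₀ J₁ Jm f g) : HasHNNForm G₀ J₁ Jm f (f * g) := by
  rcases hg with hg | ⟨h, hh, ε, x, hx, rfl⟩
  · exact (HNNReduced.pos_base hg).hasHNNForm
  · by_cases hc : ε = false ∧ h ∈ Jm
    · obtain ⟨rfl, hJ⟩ := hc
      have hmem : f * h * f⁻¹ ∈ G₀ := hJ₁G₀ ((hconj _).2 (by simpa [mul_assoc] using hJ))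
      cases hx with
      | neg_base hy =>
        simpa only [mul_assoc] using HasHNNForm.mul_left hmem (Or.inl hy)
      | neg_step hh' hx' _ =>
        simpa only [mul_assoc] using
          HasHNNForm.mul_left hmem (HasHNNForm.mul_left hh' hx'.hasHNNForm)
    · exact (HNNReduced.pos_step hh hx hc).hasHNNForm

theorem HasHNNForm.stable_inv_mul (hJmG₀ : Jm ≤ G₀)
    (hconj : ∀ x : M ≃ₜ M, x ∈ J₁ ↔ f⁻¹ * x * f ∈ Jm) {g : M ≃ₜ M}
    (hg : HasHNNForm G₀ J₁ Jm f g) : HasHNNForm G₀ J₁ Jm f (f⁻¹ * g) := by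
  rcases hg with hg | ⟨h, hh, ε, x, hx, rfl⟩
  · exact (HNNReduced.neg_base hg).hasHNNForm
  · by_cases hc : ε = true ∧ h ∈ J₁
    · obtain ⟨rfl, hJ⟩ := hc
      have hmem : f⁻¹ * h * f ∈ G₀ := hJmG₀ ((hconj _).1 hJ)
      cases hx with
      | pos_base hy =>
        simpa only [mul_assoc] using HasHNNForm.mul_left hmem (Or.inl hy)
      | pos_step hh' hx' _ =>
        simpa only [mul_assoc] using
          HasHNNForm.mul_left hmem (HasHNNForm.mul_left hh' hx'.hasHNNForm)
    · exact (HNNReduced.neg_step hh hx hc).hasHNNForm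

theorem hasHNNForm_of_mem_sup (hJ₁G₀ : J₁ ≤ G₀) (hJmG₀ : Jm ≤ G₀)
    (hconj : ∀ x : M ≃ₜ M, x ∈ J₁ ↔ f⁻¹ * x * f ∈ Jm) {g : M ≃ₜ M}
    (hg : g ∈ G₀ ⊔ Subgroup.zpowers f) : HasHNNForm G₀ J₁ Jm f g := by
  rw [Subgroup.zpowers_eq_closure, ← Subgroup.closure_eq G₀, ← Subgroup.closure_union] at hg
  induction hg using Subgroup.closure_induction_left with
  | one => exact Or.inl G₀.one_mem
  | mul_left x hx y _ ih =>
    rcases hx with hx | rfl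
    · exact ih.mul_left hx
    · exact ih.stable_mul hJ₁G₀ hconj
  | inv_mul_cancel x hx y _ ih =>
    rcases hx with hx | rfl
    · exact ih.mul_left (G₀.inv_mem hx)
    · exact ih.stable_inv_mul hJmG₀ hconj

end NormalForm

namespace HNNPingPong

variable {G₀ J₁ Jm : Subgroup (M ≃ₜ M)} {f : M ≃ₜ M} {B₁ Bm : Set M}

theorem apply_mem_interior (hpp : HNNPingPong G₀ J₁ Jm f B₁ Bm) {s : M} (hs : s ∉ Bm) :
    f s ∈ interior B₁ := by
  rw [← hpp.mapf]
  refine mem_image_of_mem _ ?_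
  by_cases h : s ∈ B₁
  · exact Or.inr h
  · exact Or.inl fun h' => h'.elim h hs

theorem inv_apply_mem (hpp : HNNPingPong G₀ J₁ Jm f B₁ Bm) {s : M} (hs : s ∉ B₁) :
    f⁻¹ s ∈ Bm := by
  by_contra h
  have := hpp.apply_mem_interior h
  rw [show f (f⁻¹ s) = s from f.apply_symm_apply s] at this
  exact hs (interior_subset this)

theorem notMem_cross (hpp : HNNPingPong G₀ J₁ Jm f B₁ Bm) {g : M ≃ₜ M} (hg : g ∈ G₀) {s : M}
    (hs : s ∈ B₁) : g s ∉ Bm := fun h =>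
  (hpp.cross g hg).subset ⟨mem_image_of_mem _ hs, h⟩

theorem notMem_cross' (hpp : HNNPingPong G₀ J₁ Jm f B₁ Bm) {g : M ≃ₜ M} (hg : g ∈ G₀) {s : M}
    (hs : s ∈ Bm) : g s ∉ B₁ := fun h => by
  refine hpp.notMem_cross (G₀.inv_mem hg) h ?_
  rwa [show g⁻¹ (g s) = s from g.symm_apply_apply s]

theorem notMem_of_not_stab (hpp : HNNPingPong G₀ J₁ Jm f B₁ Bm) {ε : Bool} {g : M ≃ₜ M}
    (hg : g ∈ G₀) (hc : ¬(ε = false ∧ g ∈ Jm)) {s : M} (hs : s ∈ cond ε B₁ Bm) : g s ∉ Bm := by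
  cases ε with
  | true => exact hpp.notMem_cross hg hs
  | false => exact fun h =>
      (hpp.precm g hg fun hJ => hc ⟨rfl, hJ⟩).subset ⟨mem_image_of_mem _ hs, h⟩

theorem notMem_of_not_stab' (hpp : HNNPingPong G₀ J₁ Jm f B₁ Bm) {ε : Bool} {g : M ≃ₜ M}
    (hg : g ∈ G₀) (hc : ¬(ε = true ∧ g ∈ J₁)) {s : M} (hs : s ∈ cond ε B₁ Bm) : g s ∉ B₁ := by
  cases ε with
  | false => exact hpp.notMem_cross' hg hs
  | true => exact fun h =>
      (hpp.prec₁ g hg fun hJ => hc ⟨rfl, hJ⟩).subset ⟨mem_image_of_mem _ hs, h⟩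

theorem apply_notMem_of_mem_base {a : M} (ha : a ∈ (⋃ g ∈ G₀, ⇑g '' (B₁ ∪ Bm))ᶜ) {g : M ≃ₜ M}
    (hg : g ∈ G₀) : g a ∉ B₁ ∪ Bm := fun h =>
  ha (mem_biUnion (G₀.inv_mem hg) ⟨g a, h, g.symm_apply_apply a⟩)

theorem reduced_apply_mem (hpp : HNNPingPong G₀ J₁ Jm f B₁ Bm) {ε : Bool} {x : M ≃ₜ M}
    (hx : HNNReduced G₀ J₁ Jm f ε x) {a : M} (ha : a ∈ (⋃ g ∈ G₀, ⇑g '' (B₁ ∪ Bm))ᶜ) :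
    x a ∈ cond ε B₁ Bm := by
  induction hx with
  | pos_base hy =>
    exact interior_subset <| hpp.apply_mem_interior fun h =>
      apply_notMem_of_mem_base ha hy (Or.inr h)
  | neg_base hy =>
    exact hpp.inv_apply_mem fun h => apply_notMem_of_mem_base ha hy (Or.inl h)
  | pos_step hh _ hc ih =>
    exact interior_subset <| hpp.apply_mem_interior (hpp.notMem_of_not_stab hh hc ih)
  | neg_step hh _ hc ih =>
    exact hpp.inv_apply_mem (hpp.notMem_of_not_stab' hh hc ih)

theorem reduced_stable_apply_mem (hpp : HNNPingPong G₀ J₁ Jm f B₁ Bm) (hJmG₀ : Jm ≤ G₀)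
    (hconj : ∀ x : M ≃ₜ M, x ∈ J₁ ↔ f⁻¹ * x * f ∈ Jm) {ε : Bool} {x : M ≃ₜ M}
    (hx : HNNReduced G₀ J₁ Jm f ε x) {a : M} (ha : a ∈ (⋃ g ∈ G₀, ⇑g '' (B₁ ∪ Bm))ᶜ) :
    x * f ∈ G₀ ∨ x (f a) ∈ cond ε B₁ Bm := by
  have hfa : f a ∈ B₁ := interior_subset <| hpp.apply_mem_interior fun h =>
    apply_notMem_of_mem_base ha G₀.one_mem (Or.inr h)
  induction hx with
  | pos_base hy =>
    exact Or.inr <| interior_subset <| hpp.apply_mem_interior (hpp.notMem_cross hy hfa)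
  | @neg_base y hy =>
    by_cases hJ : y ∈ J₁
    · exact Or.inl (hJmG₀ ((hconj y).1 hJ))
    · exact Or.inr <| hpp.inv_apply_mem <|
        hpp.notMem_of_not_stab' (ε := true) hy (fun h => hJ h.2) hfa
  | @pos_step _ h x hh _ hc ih =>
    refine Or.inr <| interior_subset <| hpp.apply_mem_interior ?_
    rcases ih with ih | ih
    · exact fun h' => apply_notMem_of_mem_base ha (G₀.mul_mem hh ih) (Or.inr h')
    · exact hpp.notMem_of_not_stab hh hc ih
  | @neg_step _ h x hh _ hc ih =>
    refine Or.inr <| hpp.inv_apply_mem ?_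
    rcases ih with ih | ih
    · exact fun h' => apply_notMem_of_mem_base ha (G₀.mul_mem hh ih) (Or.inl h')
    · exact hpp.notMem_of_not_stab' hh hc ih

/-- An element of `⟨G₀, f⟩` that keeps `a` and `f a` on their respective sides of `B₁`, where
`a` lies outside all `G₀`-translates of `B₁ ∪ Bm`, belongs to `G₀`. -/
theorem mem_of_separates (hpp : HNNPingPong G₀ J₁ Jm f B₁ Bm) (hJ₁G₀ : J₁ ≤ G₀)
    (hJmG₀ : Jm ≤ G₀) (hconj : ∀ x : M ≃ₜ M, x ∈ J₁ ↔ f⁻¹ * x * f ∈ Jm) {g : M ≃ₜ M}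
    (hg : g ∈ G₀ ⊔ Subgroup.zpowers f) {a : M} (ha : a ∈ (⋃ g ∈ G₀, ⇑g '' (B₁ ∪ Bm))ᶜ)
    (hga : g a ∉ B₁) (hgfa : g (f a) ∈ B₁) : g ∈ G₀ := by
  rcases hasHNNForm_of_mem_sup hJ₁G₀ hJmG₀ hconj hg with hg | ⟨h, hh, ε, x, hx, rfl⟩
  · exact hg
  exfalso
  rcases hpp.reduced_stable_apply_mem hJmG₀ hconj hx ha with h' | h'
  · exact apply_notMem_of_mem_base ha (G₀.mul_mem hh h') (Or.inl hgfa)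
  · by_cases hc : ε = true ∧ h ∈ J₁
    · obtain ⟨rfl, hJ⟩ := hc
      exact hga ((hpp.inv₁ h hJ).subset (mem_image_of_mem _ (hpp.reduced_apply_mem hx ha)))
    · exact hpp.notMem_of_not_stab' hh hc h' hgfa

end HNNPingPong

theorem tendsto_apply_of_tendsto_toCM {g : ℕ → M ≃ₜ M} {H : M ≃ₜ M}
    (hH : Tendsto (fun k => toCM (g k)) atTop (𝓝 (toCM H))) (x : M) :
    Tendsto (fun k => g k x) atTop (𝓝 (H x)) :=
  ((continuous_eval_const x).tendsto (toCM H)).comp hH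

theorem exists_forall_inv_mul_apply_mem [CompactSpace M] [T2Space M] {g : ℕ → M ≃ₜ M}
    {H : M ≃ₜ M} (hH : Tendsto (fun k => toCM (g k)) atTop (𝓝 (toCM H))) {U : Set M}
    (hU : IsOpen U) {a : M} (ha : a ∈ U) :
    ∀ᶠ N in atTop, ∀ m ≥ N, ∀ k ≥ N, ((g m)⁻¹ * g k) a ∈ U := by
  have hK : IsCompact Uᶜ := hU.isClosed_compl.isCompact
  have hdisj : H a ∉ H '' Uᶜ := by
    rintro ⟨y, hy, hya⟩
    exact hy (H.injective hya ▸ ha)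
  obtain ⟨V, W, hV, hW, hKV, haW, hVW⟩ :=
    SeparatedNhds.of_isCompact_isCompact (hK.image H.continuous) (isCompact_singleton (x := H a))
      (disjoint_singleton_right.2 hdisj)
  have h₁ : ∀ᶠ m in atTop, MapsTo (toCM (g m)) Uᶜ V :=
    hH.eventually (ContinuousMap.eventually_mapsTo hK hV fun y hy => hKV (mem_image_of_mem _ hy))
  have h₂ : ∀ᶠ k in atTop, g k a ∈ W :=
    (tendsto_apply_of_tendsto_toCM hH a).eventually (hW.mem_nhds (haW rfl))
  filter_upwards [eventually_forall_ge_atTop.2 (h₁.and h₂)] with N hN m hm k hk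
  by_contra hc
  have hmem : g m ((g m)⁻¹ (g k a)) ∈ V := (hN m hm).1 hc
  rw [show g m ((g m)⁻¹ (g k a)) = g k a from (g m).apply_symm_apply _] at hmem
  exact hVW.le_bot ⟨hmem, (hN k hk).2⟩

theorem not_isConvSeq_of_tendsto [T2Space M] {v : ℕ → M ≃ₜ M} (hv : Function.Injective v)
    {H : M ≃ₜ M} (hH : ∀ x, Tendsto (fun k => v k x) atTop (𝓝 (H x))) (zp zm : M) :
    ¬IsConvSeq v zp zm := by
  intro hc
  have key : ∀ y, y ≠ zm → y = H⁻¹ zp := by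
    intro y hy
    have hlim : Tendsto (fun k => v k y) atTop (𝓝 zp) := fun U hU =>
      (hc {y} isCompact_singleton (fun h => hy h.symm) U hU).mono fun k hk => hk y rfl
    rw [tendsto_nhds_unique hlim (hH y)]
    exact (H.symm_apply_apply y).symm
  have hfin : Finite M := by
    refine Set.finite_univ_iff.1 (((Set.finite_singleton (H⁻¹ zp)).insert zm).subset fun y _ => ?_)
    by_cases hy : y = zm
    · exact Or.inl hy
    · exact Or.inr (key y hy)
  have : Finite (M ≃ₜ M) := Finite.of_injective (fun g : M ≃ₜ M => (g : M → M)) DFunLike.coe_injective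
  exact not_injective_infinite_finite v hv

/-- **Theorem B(ii).** With `G₀` a discrete convergence group, `J₁, J₋₁ ≤ G₀`
geometrically finite, `f` generating an infinite cyclic discrete convergence group with
`f J₋₁ f⁻¹ = J₁`, `G₀` in HNN ping-pong position, and `G = ⟨G₀, f⟩` acting as a
convergence group: `G` is a discrete convergence group. -/
theorem statement_9 {M : Type*} [TopologicalSpace M] [CompactSpace M]
    [TopologicalSpace.MetrizableSpace M]
    (G₀ J₁ Jm G : Subgroup (M ≃ₜ M)) (f : M ≃ₜ M)
    (hd₀ : IsDiscreteConvGroup G₀)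
    (hJ₁G₀ : J₁ ≤ G₀) (hJmG₀ : Jm ≤ G₀)
    (hJ₁gf : IsGeomFinite J₁) (hJmgf : IsGeomFinite Jm)
    (hford : ¬IsOfFinOrder f) (hfd : IsDiscreteConvGroup (Subgroup.zpowers f))
    (hconj : ∀ x : M ≃ₜ M, x ∈ J₁ ↔ f⁻¹ * x * f ∈ Jm)
    (hpp : ∃ B₁ Bm : Set M, HNNPingPong G₀ J₁ Jm f B₁ Bm)
    (hG : G = G₀ ⊔ Subgroup.zpowers f) (hGconv : IsConvGroup G) :
    IsDiscreteConvGroup G := by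
  subst hG
  obtain ⟨B₁, Bm, hpp⟩ := hpp
  intro g hgG hg
  obtain ⟨φ, hφ, ⟨H, hH⟩ | hconv⟩ := hGconv g hgG hg
  swap
  · exact ⟨φ, hφ, hconv⟩
  exfalso
  obtain ⟨a, ha⟩ := hpp.proper
  have haB : a ∉ B₁ ∪ Bm := HNNPingPong.apply_notMem_of_mem_base ha G₀.one_mem
  have hfa : f a ∈ interior B₁ := hpp.apply_mem_interior fun h => haB (Or.inr h)
  obtain ⟨N, hN, hN'⟩ := ((exists_forall_inv_mul_apply_mem hH hpp.isClosed₁.isOpen_compl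
    (fun h => haB (Or.inl h))).and
      (exists_forall_inv_mul_apply_mem hH isOpen_interior hfa)).exists
  set u : ℕ → M ≃ₜ M := g ∘ φ
  have huG : ∀ k, u k ∈ G₀ ⊔ Subgroup.zpowers f := fun k => hgG (φ k)
  have hu : Function.Injective u := hg.comp hφ.injective
  set v : ℕ → M ≃ₜ M := fun k => (u N)⁻¹ * u (N + k)
  have hv : Function.Injective v := fun i j hij => Nat.add_left_cancel (hu (mul_left_cancel hij))
  have hvG₀ : ∀ k, v k ∈ G₀ := fun k =>
    hpp.mem_of_separates hJ₁G₀ hJmG₀ hconj (mul_mem (inv_mem (huG N)) (huG _)) ha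
      (hN N le_rfl _ (Nat.le_add_right N k))
      (interior_subset (hN' N le_rfl _ (Nat.le_add_right N k)))
  obtain ⟨ψ, hψ, zp, zm, hc⟩ := hd₀ v hvG₀ hv
  refine not_isConvSeq_of_tendsto (H := (u N)⁻¹ * H) (hv.comp hψ.injective) (fun x => ?_) zp zm hc
  have hlim : Tendsto (fun k => u (N + ψ k) x) atTop (𝓝 (H x)) :=
    (tendsto_apply_of_tendsto_toCM hH x).comp
      (tendsto_atTop_mono (fun k => Nat.le_add_left _ _) hψ.tendsto_atTop)
  exact (((u N)⁻¹).continuous.tendsto (H x)).comp hlim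

end ConvergenceGroups
end
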